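/- arXiv:0812.3385 — 7 statements merged into one kernel-verified Lean document; each statement's English description precedes it below -/
import Mathlib

section
/- Let p, q, r be real numbers with p > q > 0, r ≥ 0, and q·r/(p−q) < p/q, and suppose in addition that p > 1, q < 1, and r > p²·q − p. Set f(x,y) = (r + p·x + y)/(q·x + y), and let m̃, M̃ be reals with q·r/(p−q) < m̃ ≤ M̃ < p/q such that f(x,y) ∈ [m̃, M̃] for all x, y ∈ [m̃, M̃]. Then every sequence (x_n)_{n≥-1} with x_{-1}, x_0 ∈ [m̃, M̃] satisfying x_{n+1} = f(x_n, x_{n-1}) for all n ≥ 0 converges to the equilibrium ȳ = (p+1+√((p+1)² + 4r(q+1)))/(2(q+1)). -/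
open Filter Topology Set

/-- If a continuous function `V` strictly decreases along one or two steps of a continuous map `T`
away from a fixed point `E`, then every orbit staying in a compact set converges to `E`. -/
lemma tendsto_of_two_step_lyapunov {X : Type*} [TopologicalSpace X] {P K : Set X}
    {T : X → X} {V : X → ℝ} {E : X} (hP : MapsTo T P P)
    (hT : ∀ p ∈ P, ContinuousAt T p) (hV : ∀ p ∈ P, ContinuousAt V p)
    (hE : T E = E) (hinj : ∀ p ∈ P, T p = E → p = E)
    (hdec : ∀ p ∈ P, p ≠ E → V (T p) < V p ∨ V (T (T p)) < V p)
    (hK : IsCompact K) (hKP : K ⊆ P) {s : ℕ → X} (hsK : ∀ n, s n ∈ K)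
    (hs : ∀ n, s (n + 1) = T (s n)) : Tendsto s atTop (𝓝 E) := by
  set W : X → ℝ := fun p => min (V p) (V (T p)) with hW
  have hWcont : ∀ p ∈ P, ContinuousAt W p := fun p hp =>
    (hV p hp).min (ContinuousAt.comp (f := T) (hV _ (hP hp)) (hT p hp))
  have hGcont : ∀ p ∈ P, ContinuousAt (fun p => W (T (T p))) p := fun p hp =>
    ContinuousAt.comp (f := fun p => T (T p)) (hWcont _ (hP (hP hp)))
      (ContinuousAt.comp (f := T) (hT _ (hP hp)) (hT p hp))
  have hanti : Antitone (fun n => W (s n)) := by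
    refine antitone_nat_of_succ_le fun n => ?_
    by_cases h : s n = E
    · rw [hs n, h, hE]
    · simp only [hW, hs n]
      rcases hdec _ (hKP (hsK n)) h with h1 | h1
      · exact le_min ((min_le_left _ _).trans h1.le) (min_le_left _ _)
      · exact le_min ((min_le_right _ _).trans h1.le) (min_le_left _ _)
  have hstrict : ∀ p ∈ P, p ≠ E → W (T (T p)) < W p := by
    intro p hp hpE
    have h2 : W (T (T p)) < V (T p) := by
      rcases hdec _ (hP hp) (fun h => hpE (hinj p hp h)) with h | h
      · exact (min_le_left _ _).trans_lt h
      · exact (min_le_right _ _).trans_lt h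
    refine lt_min ?_ h2
    rcases hdec p hp hpE with h | h
    · exact h2.trans h
    · exact (min_le_left _ _).trans_lt h
  have hbdd : BddBelow (range fun n => W (s n)) := by
    have hc : ContinuousOn W K := fun p hp => (hWcont p (hKP hp)).continuousWithinAt
    refine (hK.bddBelow_image hc).mono ?_
    rintro _ ⟨n, rfl⟩
    exact mem_image_of_mem W (hsK n)
  have hlim := tendsto_atTop_ciInf hanti hbdd
  refine hK.tendsto_nhds_of_unique_mapClusterPt (Eventually.of_forall hsK) fun p hp hcl => ?_
  by_contra hpE
  have h1 : W p = ⨅ n, W (s n) := by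
    have := hcl.continuousAt_comp (hWcont p (hKP hp))
    exact eq_of_nhds_neBot (this.neBot.mono (inf_le_inf_left _ hlim))
  have h2 : W (T (T p)) = ⨅ n, W (s n) := by
    have := hcl.continuousAt_comp (hGcont p (hKP hp))
    have hlim2 : Tendsto ((fun p => W (T (T p))) ∘ s) atTop (𝓝 (⨅ n, W (s n))) := by
      refine ((tendsto_add_atTop_iff_nat 2).2 hlim).congr fun n => ?_
      simp only [Function.comp_apply, hs]
    exact eq_of_nhds_neBot (this.neBot.mono (inf_le_inf_left _ hlim2))
  exact (hstrict p (hKP hp) hpE).ne (h2.trans h1.symm)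

/-- The invariant of the Lyness map `(u, v) ↦ (v, (e² - e + v) / u)`, whose equilibrium is `e`. -/
noncomputable def lyness (e : ℝ) (p : ℝ × ℝ) : ℝ :=
  (1 + p.1) * (1 + p.2) * (e ^ 2 - e + p.1 + p.2) / (p.1 * p.2)

lemma lyness_sub_lyness {e u v w : ℝ} (hu : 0 < u) (hv : 0 < v) (hw : 0 < w) :
    lyness e (v, w) - lyness e (u, v)
      = (1 + v) * (w - u) * (u * w - (e ^ 2 - e) - v) / (u * v * w) := by
  simp only [lyness]
  field_simp
  ring

lemma lyness_sub_lyness_two {e u v w x : ℝ} (hu : 0 < u) (hv : 0 < v) (hw : 0 < w) (hx : 0 < x) :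
    lyness e (w, x) - lyness e (u, v)
      = ((1 + v) * (w - u) * (u * w - (e ^ 2 - e) - v) * x
        + (1 + w) * (x - v) * (v * x - (e ^ 2 - e) - w) * u) / (u * v * w * x) := by
  simp only [lyness]
  field_simp
  ring

lemma two_step_increment_neg_of_le {e u v w x c d : ℝ} (he : 1 ≤ e) (hu : 0 < u) (hv : 0 < v)
    (hc : 0 < c) (hd : 0 < d) (hcd : v ≤ w → c ≤ d)
    (hw : w * (u + c) = e ^ 2 - e + v + c * e) (hx : x * (v + d) = e ^ 2 - e + w + d * e)
    (huw : u ≤ w) (hwe : w ≤ e) (hne : ¬ (u = e ∧ v = e)) :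
    (1 + v) * (w - u) * (c * (e - w)) * x + (1 + w) * (x - v) * (d * (e - x)) * u < 0 := by
  have hw0 : 0 < w := hu.trans_le huw
  have hue : u ≤ e := huw.trans hwe
  have hE : (e - w) * (u + c) = e * u - (e ^ 2 - e) - v := by linarith
  have hX : (x - e) * (v + d) = e ^ 2 - e + w - e * v := by linarith
  have hg : 0 ≤ e * u - (e ^ 2 - e) - v := hE ▸ mul_nonneg (by linarith) (by linarith)
  have hvu : v ≤ u := by nlinarith [mul_nonneg (sub_nonneg.2 he) (sub_nonneg.2 hue)]
  have hcd' := hcd (hvu.trans huw)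
  have he2 : 0 ≤ (e ^ 2 - 1) * (e - u) := mul_nonneg (by nlinarith) (by linarith)
  have heg : 0 ≤ e * (e * u - (e ^ 2 - e) - v) := mul_nonneg (by linarith) hg
  have hsplit : e ^ 2 - e + w - e * v
      = (w - u) + e * (e * u - (e ^ 2 - e) - v) + (e ^ 2 - 1) * (e - u) := by ring
  have hpos : 0 < e ^ 2 - e + w - e * v := by
    rw [hsplit]
    rcases huw.eq_or_lt with h | h
    · rcases hg.eq_or_lt with h' | h'
      · exfalso
        have : e - w = 0 := by
          have := hE.trans h'.symm
          rcases mul_eq_zero.1 this with h1 | h1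
          · exact h1
          · linarith
        have hue' : u = e := by linarith
        subst hue'
        exact hne ⟨rfl, by nlinarith⟩
      · have : 0 < e * (e * u - (e ^ 2 - e) - v) := mul_pos (by linarith) h'
        linarith
    · linarith
  have hxe : 0 < x - e := by
    by_contra h
    have : (x - e) * (v + d) ≤ 0 := mul_nonpos_of_nonpos_of_nonneg (by linarith) (by linarith)
    linarith
  have hx0 : 0 < x := by linarith
  have hxv : 0 < x - v := by linarith
  have h1 : w - u ≤ e ^ 2 - e + w - e * v := by linarith
  have h2 : c * (v + d) ≤ d * (u + c) := by
    nlinarith [mul_nonneg hd.le (sub_nonneg.2 hvu), mul_nonneg hv.le (sub_nonneg.2 hcd')]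
  have h3 : (e * u - (e ^ 2 - e) - v) * x ≤ u * (x - v) := by
    have ha : e * (e * u - (e ^ 2 - e) - v) ≤ u * (e - v) := by
      nlinarith [mul_nonneg hv.le (sub_nonneg.2 hue),
        mul_nonneg (mul_nonneg (sub_nonneg.2 hue) (sub_nonneg.2 he)) (by linarith : (0:ℝ) ≤ e)]
    have hb : e * u - (e ^ 2 - e) - v ≤ u := by
      nlinarith [mul_nonneg (sub_nonneg.2 he) (sub_nonneg.2 hue)]
    nlinarith [mul_nonneg hxe.le (sub_nonneg.2 hb)]
  have hmain : (1 + v) * (w - u) * (c * (v + d)) * ((e * u - (e ^ 2 - e) - v) * x)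
      < (1 + w) * (e ^ 2 - e + w - e * v) * (d * (u + c)) * (u * (x - v)) := by
    rcases hg.eq_or_lt with h' | h'
    · rw [← h']
      have : 0 < (1 + w) * (e ^ 2 - e + w - e * v) * (d * (u + c)) * (u * (x - v)) := by positivity
      linarith
    · have h1' : w - u < e ^ 2 - e + w - e * v := by
        have : 0 < e * (e * u - (e ^ 2 - e) - v) := mul_pos (by linarith) h'
        linarith
      have s1 : (1 + v) * (w - u) < (1 + w) * (e ^ 2 - e + w - e * v) :=
        mul_lt_mul' (by linarith) h1' (by linarith) (by linarith)
      have s2 : (1 + v) * (w - u) * (c * (v + d))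
          < (1 + w) * (e ^ 2 - e + w - e * v) * (d * (u + c)) :=
        mul_lt_mul s1 h2 (by positivity) (by positivity)
      exact mul_lt_mul s2 h3 (by positivity) (by positivity)
  have hkey : ((1 + v) * (w - u) * (c * (e - w)) * x + (1 + w) * (x - v) * (d * (e - x)) * u)
      * ((u + c) * (v + d)) < 0 := by
    have : ((1 + v) * (w - u) * (c * (e - w)) * x + (1 + w) * (x - v) * (d * (e - x)) * u)
        * ((u + c) * (v + d))
        = (1 + v) * (w - u) * (c * (v + d)) * (((e - w) * (u + c)) * x)
          - (1 + w) * ((x - e) * (v + d)) * (d * (u + c)) * (u * (x - v)) := by ring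
    rw [this, hE, hX]
    linarith
  exact neg_of_mul_neg_left hkey (by positivity)

set_option maxRecDepth 20000 in
lemma lyness_polynomial_bound {e u v w : ℝ} (he : 1 ≤ e) (hw : e ≤ w) (hu : w ≤ u)
    (hv : u * w ≤ e ^ 2 - e + v) :
    (1 + v) * (u - w) * (e * w * (e ^ 2 - e + v - u * w) + (e ^ 2 - e + w) * v * (w - e))
      ≤ (1 + w) * w * u * (e * v - (e ^ 2 - e) - w) * (v - e) := by
  obtain ⟨h, hh, rfl⟩ : ∃ h, 0 ≤ h ∧ e = 1 + h := ⟨e - 1, by linarith, by ring⟩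
  obtain ⟨s, hs, rfl⟩ : ∃ s, 0 ≤ s ∧ w = 1 + h + s := ⟨w - (1 + h), by linarith, by ring⟩
  obtain ⟨t, ht, rfl⟩ : ∃ t, 0 ≤ t ∧ u = 1 + h + s + t := ⟨u - (1 + h + s), by linarith, by ring⟩
  obtain ⟨k, hk, rfl⟩ : ∃ k, 0 ≤ k ∧
      v = (1 + h + s + t) * (1 + h + s) - ((1 + h) ^ 2 - (1 + h)) + k :=
    ⟨v - ((1 + h + s + t) * (1 + h + s) - ((1 + h) ^ 2 - (1 + h))), by linarith, by ring⟩
  rw [← sub_nonneg]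
  ring_nf
  positivity

lemma two_step_increment_neg_of_ge {e u v w x c d : ℝ} (he : 1 ≤ e) (hv : 0 < v)
    (hc : 0 < c) (hd : 0 < d) (hcd : w ≤ v → c * w ≤ d * v)
    (hw : w * (u + c) = e ^ 2 - e + v + c * e) (hx : x * (v + d) = e ^ 2 - e + w + d * e)
    (hwu : w ≤ u) (hew : e ≤ w) (hne : ¬ (u = e ∧ v = e)) :
    (1 + v) * (w - u) * (c * (e - w)) * x + (1 + w) * (x - v) * (d * (e - x)) * u < 0 := by
  have hw0 : 0 < w := by linarith
  have hu0 : 0 < u := by linarith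
  have hK : c * (w - e) = e ^ 2 - e + v - u * w := by linarith
  have hX : (e - x) * (v + d) = e * v - (e ^ 2 - e) - w := by linarith
  have hK0 : 0 ≤ e ^ 2 - e + v - u * w := hK ▸ mul_nonneg hc.le (by linarith)
  have hue : e < u := by
    refine lt_of_le_of_ne (hew.trans hwu) fun h => ?_
    have hwe : w = e := by linarith
    subst hwe
    subst h
    exact hne ⟨rfl, by nlinarith⟩
  have huw : e * (u - e) + (w - e) ≤ u * w - e ^ 2 := by
    nlinarith [mul_nonneg (sub_nonneg.2 hew) (by linarith : 0 ≤ u - 1)]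
  have heu : 0 < e * (u - e) := mul_pos (by linarith) (by linarith)
  have hve : 0 < v - e := by linarith
  have hwv : w ≤ v := by linarith
  have hpos : 0 < e * v - (e ^ 2 - e) - w := by
    nlinarith [mul_nonneg (sub_nonneg.2 he) hve.le]
  have hex : 0 < e - x := by
    by_contra h
    have : (e - x) * (v + d) ≤ 0 := mul_nonpos_of_nonpos_of_nonneg (by linarith) (by linarith)
    linarith
  have hbound : w * ((e ^ 2 - e + v - u * w) * (e ^ 2 - e + w + d * e))
      ≤ d * (e * w * (e ^ 2 - e + v - u * w) + (e ^ 2 - e + w) * v * (w - e)) := by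
    have h1 : w * (e ^ 2 - e + v - u * w) ≤ d * v * (w - e) := by
      rw [← hK]
      nlinarith [mul_le_mul_of_nonneg_right (hcd hwv) (sub_nonneg.2 hew)]
    have h2 : 0 ≤ e ^ 2 - e + w := by nlinarith
    nlinarith [mul_le_mul_of_nonneg_right h1 h2]
  have hpoly := lyness_polynomial_bound (v := v) he hew hwu (by linarith)
  have hmain : w * ((1 + v) * (u - w) * (e ^ 2 - e + v - u * w) * (e ^ 2 - e + w + d * e))
      < w * ((1 + w) * (v - x) * d * (e * v - (e ^ 2 - e) - w) * u) := by
    calc w * ((1 + v) * (u - w) * (e ^ 2 - e + v - u * w) * (e ^ 2 - e + w + d * e))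
        = (1 + v) * (u - w)
          * (w * ((e ^ 2 - e + v - u * w) * (e ^ 2 - e + w + d * e))) := by ring
      _ ≤ (1 + v) * (u - w)
          * (d * (e * w * (e ^ 2 - e + v - u * w) + (e ^ 2 - e + w) * v * (w - e))) :=
        mul_le_mul_of_nonneg_left hbound (mul_nonneg (by linarith) (by linarith))
      _ = d * ((1 + v) * (u - w)
          * (e * w * (e ^ 2 - e + v - u * w) + (e ^ 2 - e + w) * v * (w - e))) := by ring
      _ ≤ d * ((1 + w) * w * u * (e * v - (e ^ 2 - e) - w) * (v - e)) :=
        mul_le_mul_of_nonneg_left hpoly hd.le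
      _ = d * ((1 + w) * w * u * (e * v - (e ^ 2 - e) - w)) * (v - e) := by ring
      _ < d * ((1 + w) * w * u * (e * v - (e ^ 2 - e) - w)) * (v - x) :=
        mul_lt_mul_of_pos_left (by linarith) (by positivity)
      _ = w * ((1 + w) * (v - x) * d * (e * v - (e ^ 2 - e) - w) * u) := by ring
  have hkey : ((1 + v) * (w - u) * (c * (e - w)) * x + (1 + w) * (x - v) * (d * (e - x)) * u)
      * (v + d) < 0 := by
    have : ((1 + v) * (w - u) * (c * (e - w)) * x + (1 + w) * (x - v) * (d * (e - x)) * u)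
        * (v + d) = (1 + v) * (u - w) * (c * (w - e)) * (x * (v + d))
          - (1 + w) * (v - x) * d * ((e - x) * (v + d)) * u := by ring
    rw [this, hK, hX, hx]
    linarith [lt_of_mul_lt_mul_left hmain hw0.le]
  exact neg_of_mul_neg_left hkey (by positivity)

/-- A Lyness map whose second coordinate is pulled towards the equilibrium `e`. -/
noncomputable def dampedLyness (e A q : ℝ) (p : ℝ × ℝ) : ℝ × ℝ :=
  (p.2, (e ^ 2 - e + p.2 + (A + q * p.2) * e) / (p.1 + (A + q * p.2)))

lemma lyness_decreases {e A q : ℝ} (he : 1 ≤ e) (hA : 0 < A) (hq : 0 < q) {p : ℝ × ℝ}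
    (hp : p ∈ Ioi (0 : ℝ) ×ˢ Ioi (0 : ℝ)) (hne : p ≠ (e, e)) :
    lyness e (dampedLyness e A q p) < lyness e p
      ∨ lyness e (dampedLyness e A q (dampedLyness e A q p)) < lyness e p := by
  obtain ⟨u, v⟩ := p
  obtain ⟨hu, hv⟩ : 0 < u ∧ 0 < v := hp
  have ha : 0 ≤ e ^ 2 - e := by nlinarith
  simp only [dampedLyness]
  set w := (e ^ 2 - e + v + (A + q * v) * e) / (u + (A + q * v)) with hw
  set x := (e ^ 2 - e + w + (A + q * w) * e) / (v + (A + q * w)) with hx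
  have hw0 : 0 < w := by positivity
  have hx0 : 0 < x := by positivity
  have hwm : w * (u + (A + q * v)) = e ^ 2 - e + v + (A + q * v) * e :=
    div_mul_cancel₀ _ (by positivity)
  have hxm : x * (v + (A + q * w)) = e ^ 2 - e + w + (A + q * w) * e :=
    div_mul_cancel₀ _ (by positivity)
  have hc : 0 < A + q * v := by positivity
  have hd : 0 < A + q * w := by positivity
  have hne' : ¬ (u = e ∧ v = e) := fun h => hne (by rw [h.1, h.2])
  have hw' : u * w - (e ^ 2 - e) - v = (A + q * v) * (e - w) := by linarith
  have hx' : v * x - (e ^ 2 - e) - w = (A + q * w) * (e - x) := by linarith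
  by_cases hs : (w - u) * (e - w) < 0
  · left
    rw [← sub_neg, lyness_sub_lyness hu hv hw0, hw']
    refine div_neg_of_neg_of_pos ?_ (by positivity)
    have : (1 + v) * (w - u) * ((A + q * v) * (e - w))
        = (1 + v) * (A + q * v) * ((w - u) * (e - w)) := by ring
    rw [this]
    exact mul_neg_of_pos_of_neg (by positivity) hs
  · right
    rw [← sub_neg, lyness_sub_lyness_two hu hv hw0 hx0, hw', hx']
    refine div_neg_of_neg_of_pos ?_ (by positivity)
    have hcase : (u ≤ w ∧ w ≤ e) ∨ (w ≤ u ∧ e ≤ w) := by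
      rcases le_total u w with h1 | h1 <;> rcases le_total w e with h2 | h2
      · exact Or.inl ⟨h1, h2⟩
      · rcases h1.eq_or_lt with h | h
        · exact Or.inr ⟨h.ge, h2⟩
        · rcases h2.eq_or_lt with h' | h'
          · exact Or.inl ⟨h1, h'.ge⟩
          · exact absurd (mul_neg_of_pos_of_neg (sub_pos.2 h) (sub_neg.2 h')) hs
      · rcases h1.eq_or_lt with h | h
        · exact Or.inl ⟨h.ge, h2⟩
        · rcases h2.eq_or_lt with h' | h'
          · exact Or.inr ⟨h1, h'.ge⟩
          · exact absurd (mul_neg_of_neg_of_pos (sub_neg.2 h) (sub_pos.2 h')) hs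
      · exact Or.inr ⟨h1, h2⟩
    rcases hcase with ⟨h1, h2⟩ | ⟨h1, h2⟩
    · exact two_step_increment_neg_of_le he hu hv hc hd (fun h => by gcongr) hwm hxm h1 h2 hne'
    · exact two_step_increment_neg_of_ge he hv hc hd
        (fun h => by nlinarith [mul_nonneg hA.le (sub_nonneg.2 h)]) hwm hxm h1 h2 hne'

lemma tendsto_of_dampedLyness {e A q δ C : ℝ} (he : 1 ≤ e) (hA : 0 < A) (hq : 0 < q) (hδ : 0 < δ)
    {t : ℕ → ℝ} (ht : ∀ n, t n ∈ Icc δ C)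
    (hrec : ∀ n, t (n + 2) * (t n + (A + q * t (n + 1)))
      = e ^ 2 - e + t (n + 1) + (A + q * t (n + 1)) * e) :
    Tendsto t atTop (𝓝 e) := by
  have ha : 0 ≤ e ^ 2 - e := by nlinarith
  have he0 : 0 < e := by linarith
  have hden : ∀ p ∈ Ioi (0 : ℝ) ×ˢ Ioi (0 : ℝ), 0 < p.1 + (A + q * p.2) := by
    rintro ⟨u, v⟩ ⟨hu, hv⟩
    simp only [mem_Ioi] at hu hv
    positivity
  have h : Tendsto (fun n => (t n, t (n + 1))) atTop (𝓝 (e, e)) := by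
    refine tendsto_of_two_step_lyapunov (P := Ioi (0 : ℝ) ×ˢ Ioi (0 : ℝ))
      (K := Icc δ C ×ˢ Icc δ C) (T := dampedLyness e A q) (V := lyness e) ?_ ?_ ?_ ?_ ?_
      (fun p hp hne => lyness_decreases he hA hq hp hne) (isCompact_Icc.prod isCompact_Icc)
      ?_ (fun n => ⟨ht n, ht (n + 1)⟩) ?_
    · rintro ⟨u, v⟩ ⟨hu, hv⟩
      simp only [mem_Ioi] at hu hv
      refine ⟨hv, ?_⟩
      simp only [dampedLyness, mem_Ioi]
      positivity
    · intro p hp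
      have := (hden p hp).ne'
      unfold dampedLyness
      fun_prop (disch := assumption)
    · intro p hp
      have : p.1 * p.2 ≠ 0 := (mul_pos hp.1 hp.2).ne'
      unfold lyness
      fun_prop (disch := assumption)
    · have : e + (A + q * e) ≠ 0 := by positivity
      simp only [dampedLyness, Prod.mk.injEq, true_and]
      rw [div_eq_iff this]
      ring
    · rintro ⟨u, v⟩ hp hpe
      have hd := hden _ hp
      simp only [dampedLyness, Prod.mk.injEq] at hpe hd
      obtain ⟨rfl, h2⟩ := hpe
      rw [div_eq_iff hd.ne'] at h2
      have : v * (u - v) = 0 := by linarith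
      have : u = v := by
        rcases mul_eq_zero.1 this with h | h <;> linarith
      rw [this]
    · rintro ⟨u, v⟩ ⟨hu, hv⟩
      exact ⟨hδ.trans_le hu.1, hδ.trans_le hv.1⟩
    · intro n
      have hpos : 0 < t n + (A + q * t (n + 1)) :=
        hden (t n, t (n + 1)) ⟨hδ.trans_le (ht n).1, hδ.trans_le (ht (n + 1)).1⟩
      simp only [dampedLyness, Prod.mk.injEq, true_and]
      rw [eq_div_iff hpos.ne', hrec n]
  exact (continuous_fst.tendsto _).comp h

/-- Lemma: under the hypotheses of the proposition, if moreover `p > 1`, `q < 1` and `r > p²q − p`, every solution starting in the invariant interval converges to the equilibrium.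
Here `x 0` plays the role of `x_{-1}` and `x 1` of `x_0`. -/
theorem stmt_11 (p q r : ℝ) (hq : 0 < q) (hpq : q < p) (hr : 0 ≤ r)
    (hcond : q * r / (p - q) < p / q)
    (hp1 : 1 < p) (hq1 : q < 1) (hextra : p ^ 2 * q - p < r)
    (mt Mt : ℝ) (hmt : q * r / (p - q) < mt) (hmM : mt ≤ Mt) (hMt : Mt < p / q)
    (hinv : ∀ x ∈ Icc mt Mt, ∀ y ∈ Icc mt Mt,
      (r + p * x + y) / (q * x + y) ∈ Icc mt Mt)
    (x : ℕ → ℝ) (hx0 : x 0 ∈ Icc mt Mt) (hx1 : x 1 ∈ Icc mt Mt)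
    (hrec : ∀ n : ℕ, x (n + 2) = (r + p * x (n + 1) + x n) / (q * x (n + 1) + x n)) :
    Tendsto x atTop
      (nhds ((p + 1 + Real.sqrt ((p + 1) ^ 2 + 4 * r * (q + 1))) / (2 * (q + 1)))) := by
  have hp0 : 0 < p := hq.trans hpq
  have hpq0 : 0 < p - q := sub_pos.2 hpq
  have hmt0 : 0 < mt := (div_nonneg (mul_nonneg hq.le hr) hpq0.le).trans_lt hmt
  set D := (p + 1) ^ 2 + 4 * r * (q + 1) with hD
  set z := (p + 1 + Real.sqrt D) / (2 * (q + 1)) with hz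
  have hD0 : 0 ≤ D := by positivity
  have hsq : Real.sqrt D ^ 2 = D := Real.sq_sqrt hD0
  have hz0 : 0 < z := by positivity
  have hs : Real.sqrt D = 2 * (q + 1) * z - (p + 1) := by
    rw [hz]
    field_simp
    ring
  have hzeq : (q + 1) * z ^ 2 = (p + 1) * z + r := by
    have h : 4 * (q + 1) * ((q + 1) * z ^ 2 - ((p + 1) * z + r)) = 0 := by
      rw [hs, hD] at hsq
      linarith
    rcases mul_eq_zero.1 h with h | h <;> linarith
  have hzge : p + 1 ≤ (q + 1) * z := by
    by_contra! h
    nlinarith [mul_lt_mul_of_pos_right h hz0]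
  have hzlt : q * z < p := by
    have hc : q ^ 2 * r < p * (p - q) := by
      rw [div_lt_div_iff₀ hpq0 hq] at hcond
      linarith
    by_contra! h
    have h1 : 0 ≤ (q * z - p) * ((q + 1) * (q * z + p) - q * (p + 1)) :=
      mul_nonneg (by linarith) (by nlinarith)
    have h2 : q ^ 2 * ((q + 1) * z ^ 2) = q ^ 2 * ((p + 1) * z + r) := by rw [hzeq]
    linarith
  set b := p - q * z with hb
  have hb0 : 0 < b := sub_pos.2 hzlt
  have hxmem : ∀ n, x n ∈ Icc mt Mt ∧ x (n + 1) ∈ Icc mt Mt := by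
    intro n
    induction n with
    | zero => exact ⟨hx0, hx1⟩
    | succ n ih => exact ⟨ih.2, hrec n ▸ hinv _ ih.2 _ ih.1⟩
  have hxpos : ∀ n, 0 < x n := fun n => hmt0.trans_le (hxmem n).1.1
  have hxm : ∀ n, x (n + 2) * (q * x (n + 1) + x n) = r + p * x (n + 1) + x n := by
    intro n
    have := hxpos n
    have := hxpos (n + 1)
    rw [hrec n, div_mul_cancel₀ _ (by positivity)]
  have hMt0 : 0 < Mt := hmt0.trans_le hmM
  have hlow : ∀ n, (p - q) * mt / ((q + 1) * Mt) ≤ x (n + 2) - 1 := by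
    intro n
    have h1 := hxm n
    have h2 := (hxmem n).1
    have h3 := (hxmem n).2
    have h4 : 0 < q * x (n + 1) + x n := by
      have := hxpos n
      have := hxpos (n + 1)
      positivity
    have h5 : q * x (n + 1) + x n ≤ (q + 1) * Mt := by nlinarith [h2.2, h3.2]
    have h6 : x (n + 2) - 1 = (r + (p - q) * x (n + 1)) / (q * x (n + 1) + x n) := by
      rw [eq_div_iff h4.ne']
      linarith
    rw [h6]
    refine div_le_div₀ ?_ ?_ h4 h5
    · have := hxpos (n + 1)
      positivity
    · nlinarith [mul_le_mul_of_nonneg_left h3.1 hpq0.le]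
  have hA : 0 < (1 + q) / b := by positivity
  have he : 1 ≤ (z - 1) / b := by
    rw [le_div_iff₀ hb0]
    linarith
  have hlim : Tendsto (fun n => (x (n + 2) - 1) / b) atTop (𝓝 ((z - 1) / b)) := by
    refine tendsto_of_dampedLyness (A := (1 + q) / b) (q := q)
      (δ := (p - q) * mt / ((q + 1) * Mt) / b) (C := (Mt - 1) / b) he hA hq (by positivity)
      (fun n => ⟨?_, ?_⟩) fun n => ?_
    · gcongr
      exact hlow n
    · have := (hxmem (n + 2)).1.2
      gcongr
    · have h1 := hxm (n + 2)
      field_simp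
      rw [hb]
      linear_combination h1 - hzeq
  have h := (hlim.mul_const b).add_const 1
  simp only [div_mul_cancel₀ _ hb0.ne', sub_add_cancel] at h
  exact (tendsto_add_atTop_iff_nat 2).1 h
end

section
/- Let b, g, u be real numbers with 0 < b < 1, 0 < g < 1, 1 < u < 1/b, and (g+1)/(b+1) ≤ u. Define T : (0,∞)² → (0,∞)² by T(x,y) = (y, ((b+1)u² − (g+1)u + y + g·x)/(b·y + x)), and define G(x,y) = (1+x)(1+y)(u² − u + x + y)/(x·y). Suppose x, y > 0 satisfy either (x ≤ u and u ≤ y) or (u ≤ x and y ≤ u), and (x,y) ≠ (u,u). Then G(T(x,y)) < G(x,y). -/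
open Set

/-- One Lyness step lowers the invariant when the factors `x - z` and `x * z - (A + y)`
have the same strict sign. -/
theorem lyness_invariant_lt {A x y z : ℝ} (hx : 0 < x) (hy : 0 < y) (hz : 0 < z)
    (h : 0 < (x - z) * (x * z - (A + y))) :
    (1 + y) * (1 + z) * (A + y + z) / (y * z) < (1 + x) * (1 + y) * (A + x + y) / (x * y) := by
  have key : (1 + x) * (1 + y) * (A + x + y) / (x * y)
      - (1 + y) * (1 + z) * (A + y + z) / (y * z)
      = (1 + y) * ((x - z) * (x * z - (A + y))) / (x * y * z) := by
    field_simp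
    ring
  have : 0 < (1 + y) * ((x - z) * (x * z - (A + y))) / (x * y * z) := by positivity
  linarith

/-- Claim: on the quadrants `Q₂(u,u) ∪ Q₄(u,u)` (minus `(u,u)`), the Lyness invariant `G` strictly decreases along one step of the map `T` associated with the normalized equation. -/
theorem stmt_13 (b g u : ℝ)
    (hb0 : 0 < b) (hb1 : b < 1) (hg0 : 0 < g) (hg1 : g < 1)
    (hu1 : 1 < u) (hub : u < 1 / b) (hgu : (g + 1) / (b + 1) ≤ u)
    (T : ℝ × ℝ → ℝ × ℝ)
    (hT : ∀ P : ℝ × ℝ, T P =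
      (P.2, ((b + 1) * u ^ 2 - (g + 1) * u + P.2 + g * P.1) / (b * P.2 + P.1)))
    (G : ℝ × ℝ → ℝ)
    (hG : ∀ P : ℝ × ℝ, G P = (1 + P.1) * (1 + P.2) * (u ^ 2 - u + P.1 + P.2) / (P.1 * P.2))
    (x y : ℝ) (hx : 0 < x) (hy : 0 < y)
    (hQ : (x ≤ u ∧ u ≤ y) ∨ (u ≤ x ∧ y ≤ u))
    (hne : (x, y) ≠ (u, u)) :
    G (T (x, y)) < G (x, y) := by
  have hub' : 0 < 1 - b * u := by
    rw [lt_div_iff₀ hb0] at hub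
    linarith
  have hr : 0 ≤ (b + 1) * u ^ 2 - (g + 1) * u := by
    rw [div_le_iff₀ (by linarith)] at hgu
    nlinarith
  have hD : 0 < b * y + x := by positivity
  rw [hT, hG, hG]
  dsimp only
  set z := ((b + 1) * u ^ 2 - (g + 1) * u + y + g * x) / (b * y + x) with hz
  have hz0 : 0 < z := by positivity
  have hxz : x - z = ((x - u) * (x + u - g + b * y) + (1 - b * u) * (u - y)) / (b * y + x) := by
    rw [hz]
    field_simp
    ring
  have hxzc : x * z - (u ^ 2 - u + y)
      = (b * (u ^ 2 * (x - y) + y * (u - y)) + g * x * (x - u)) / (b * y + x) := by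
    rw [hz]
    field_simp
    ring
  refine lyness_invariant_lt hx hy hz0 ?_
  rw [hxz, hxzc]
  have hs : 0 < x + u - g + b * y := by nlinarith [mul_pos hb0 hy]
  have hxy : x ≠ y := by
    rintro rfl
    refine hne ?_
    have : x = u := by rcases hQ with h | h <;> linarith
    rw [this]
  rcases hQ with ⟨hxu, huy⟩ | ⟨hux, hyu⟩
  · have hlt : x < y := lt_of_le_of_ne (hxu.trans huy) hxy
    have h₁ : (x - u) * (x + u - g + b * y) + (1 - b * u) * (u - y) < 0 := by
      rcases hxu.lt_or_eq with h | h
      · nlinarith [mul_pos (sub_pos.2 h) hs, mul_nonneg hub'.le (sub_nonneg.2 huy)]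
      · subst h
        nlinarith [mul_pos hub' (sub_pos.2 hlt)]
    have h₂ : b * (u ^ 2 * (x - y) + y * (u - y)) + g * x * (x - u) < 0 := by
      have e₁ : 0 < b * (u ^ 2 * (y - x)) := by
        have := sub_pos.2 hlt
        positivity
      have e₂ : 0 ≤ b * (y * (y - u)) := by
        have := sub_nonneg.2 huy
        positivity
      have e₃ : 0 ≤ g * x * (u - x) := by
        have := sub_nonneg.2 hxu
        positivity
      linarith
    exact mul_pos_of_neg_of_neg (div_neg_of_neg_of_pos h₁ hD) (div_neg_of_neg_of_pos h₂ hD)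
  · have hlt : y < x := lt_of_le_of_ne (hyu.trans hux) hxy.symm
    have hux' := sub_nonneg.2 hux
    have hyu' := sub_nonneg.2 hyu
    have h₁ : 0 < (x - u) * (x + u - g + b * y) + (1 - b * u) * (u - y) := by
      rcases hux.lt_or_eq with h | h
      · have := sub_pos.2 h
        positivity
      · subst h
        nlinarith [mul_pos hub' (sub_pos.2 hlt)]
    have h₂ : 0 < b * (u ^ 2 * (x - y) + y * (u - y)) + g * x * (x - u) := by
      have := sub_pos.2 hlt
      positivity
    positivity
end

section
/- Let b, g, u be real numbers with 0 < b < 1, 0 < g < 1, 1 < u < 1/b, (g+1)/(b+1) ≤ u, and g > b. Define T : (0,∞)² → (0,∞)² by T(x,y) = (y, ((b+1)u² − (g+1)u + y + g·x)/(b·y + x)), and define G(x,y) = (1+x)(1+y)(u² − u + x + y)/(x·y). Suppose x, y > 0 satisfy either (u ≤ x and u ≤ y) or (x ≤ u and y ≤ u), and (x,y) ≠ (u,u). Then G(T(T(x,y))) < G(x,y). -/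
open Set

/-- The change of the Lyness invariant when `(x, y)` is replaced by `(y, z)`. -/
lemma lyness_invariant_sub (A x y z : ℝ) (hx : x ≠ 0) (hy : y ≠ 0) (hz : z ≠ 0) :
    (1 + y) * (1 + z) * (A + y + z) / (y * z) - (1 + x) * (1 + y) * (A + x + y) / (x * y) =
      (1 + y) * (z - x) * (x * z - A - y) / (x * y * z) := by
  field_simp
  ring

/-- How far a solution `z` of the second-order recurrence is from the Lyness recurrence. -/
lemma lyness_defect (b g u x y z : ℝ)
    (hz : z * (b * y + x) = (b + 1) * u ^ 2 - (g + 1) * u + y + g * x) :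
    (x * z - (u ^ 2 - u) - y) * (b * y + x) =
      b * (x - y) * (x + y + (u ^ 2 - u)) + (g - b) * x * (x - u) := by
  linear_combination x * hz

section LowerQuadrant

variable {b g u x y z w : ℝ}

lemma lower_le_next (hb : 0 < b) (hu : 1 < u) (hbu : b * u < 1) (hr : g + 1 ≤ (b + 1) * u)
    (hx : 0 < x) (hy : 0 < y) (hxu : x ≤ u) (hyu : y ≤ u)
    (hz : z * (b * y + x) = (b + 1) * u ^ 2 - (g + 1) * u + y + g * x) : y ≤ z := by
  have hD : 0 < b * y + x := by positivity
  have h1 : 0 ≤ u * ((b + 1) * u - (g + 1)) + y * (1 - b * y) := by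
    have : b * y ≤ b * u := by gcongr
    have h2 : 0 ≤ y * (1 - b * y) := mul_nonneg hy.le (by linarith)
    have h3 : 0 ≤ u * ((b + 1) * u - (g + 1)) := mul_nonneg (by linarith) (by linarith)
    linarith
  have h2 : 0 ≤ (u - y) * (u - 1 + b * (u + y)) :=
    mul_nonneg (by linarith) (by have : 0 < b * (u + y) := by positivity
                                 linarith)
  have h3 : 0 ≤ u * ((b * y + x) * (z - y)) := by
    have e : u * ((b * y + x) * (z - y)) =
        (u - x) * (u * ((b + 1) * u - (g + 1)) + y * (1 - b * y)) +
          x * ((u - y) * (u - 1 + b * (u + y))) := by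
      linear_combination u * hz
    rw [e]
    exact add_nonneg (mul_nonneg (by linarith) h1) (mul_nonneg hx.le h2)
  have h4 := nonneg_of_mul_nonneg_right h3 (by linarith)
  linarith [nonneg_of_mul_nonneg_right h4 hD]

lemma lower_le_next_next (hb : 0 < b) (hbu : b * u < 1) (hr : g + 1 ≤ (b + 1) * u)
    (hy : 0 < y) (hyu : y ≤ u) (hyz : y ≤ z)
    (hw : w * (b * z + y) = (b + 1) * u ^ 2 - (g + 1) * u + z + g * y) :
    y ≤ w ∧ (y < u → y < w) := by
  have hz : 0 < z := by linarith
  have hD : 0 < b * z + y := by positivity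
  have hby : b * y ≤ b * u := by gcongr
  have h1 : 0 ≤ (z - y) * (1 - b * y) := mul_nonneg (by linarith) (by linarith)
  have h2 : 0 < (b + 1) * (u + y) - (g + 1) := by
    have : 0 < (b + 1) * y := by positivity
    linarith
  have e : (b * z + y) * (w - y) =
      (z - y) * (1 - b * y) + (u - y) * ((b + 1) * (u + y) - (g + 1)) := by
    linear_combination hw
  constructor
  · have h3 : 0 ≤ (b * z + y) * (w - y) := by
      rw [e]
      exact add_nonneg h1 (mul_nonneg (by linarith) h2.le)
    linarith [nonneg_of_mul_nonneg_right h3 hD]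
  · intro hlt
    have h3 : 0 < (b * z + y) * (w - y) := by
      rw [e]
      exact add_pos_of_nonneg_of_pos h1 (mul_pos (by linarith) h2)
    linarith [pos_of_mul_pos_right h3 hD.le]

lemma lower_mul_le (hb : 0 < b) (hu : 1 < u) (hr : g + 1 ≤ (b + 1) * u)
    (hx : 0 < x) (hy : 0 < y) (hxu : x ≤ u) (hyx : y ≤ x) (hyz : y ≤ z)
    (hw : w * (b * z + y) = (b + 1) * u ^ 2 - (g + 1) * u + z + g * y) : x * y ≤ z * w := by
  have hz0 : 0 < z := by linarith
  have hD : 0 < b * z + y := by positivity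
  have h1 : 0 ≤ x * (u * ((b + 1) * u - (g + 1)) + y * (1 + g - (1 + b) * x)) := by
    have e : x * (u * ((b + 1) * u - (g + 1)) + y * (1 + g - (1 + b) * x)) =
        (x - y) * (u * ((b + 1) * u - (g + 1))) +
          y * ((u - x) * ((b + 1) * (u + x) - (g + 1))) := by ring
    have h3 : 0 ≤ u * ((b + 1) * u - (g + 1)) := mul_nonneg (by linarith) (by linarith)
    have h5 : 0 ≤ (b + 1) * (u + x) - (g + 1) := by
      have : 0 < (b + 1) * x := by positivity
      linarith
    rw [e]
    exact add_nonneg (mul_nonneg (by linarith) h3)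
      (mul_nonneg hy.le (mul_nonneg (by linarith) h5))
  have h2 := nonneg_of_mul_nonneg_right h1 hx
  have h3 : 0 ≤ (b * z + y) * (z * w - x * y) := by
    have e : (b * z + y) * (z * w - x * y) =
        z * (u * ((b + 1) * u - (g + 1)) + y * (1 + g - (1 + b) * x)) +
          (z - y) * (z + x * y) := by
      linear_combination z * hw
    rw [e]
    exact add_nonneg (mul_nonneg hz0.le h2) (mul_nonneg (by linarith) (by positivity))
  linarith [nonneg_of_mul_nonneg_right h3 hD]

lemma lower_defect_lt (hb : 0 < b) (hg : 0 < g) (hy : 0 < y) (hyx : y < x) (hyz : y ≤ z)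
    (hz : z * (b * y + x) = (b + 1) * u ^ 2 - (g + 1) * u + y + g * x)
    (hw : w * (b * z + y) = (b + 1) * u ^ 2 - (g + 1) * u + z + g * y) :
    y * w - (u ^ 2 - u) - z < x * z - (u ^ 2 - u) - y := by
  have hz0 : 0 < z := by linarith
  have hD : 0 < b * z + y := by positivity
  have h1 : 0 < (b * z + y) * (x * z - y + z - y * w) := by
    have e : (b * z + y) * (x * z - y + z - y * w) =
        g * y * (x - y) + b * z * (z * (x - y) + (z - y) * (1 + y)) := by
      linear_combination y * hz - y * hw
    have hxy := sub_pos.2 hyx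
    have hzy := sub_nonneg.2 hyz
    rw [e]
    positivity
  linarith [pos_of_mul_pos_right h1 hD.le]

lemma lower_descent_of_lt (hb : 0 < b) (hgb : b < g) (hg1 : g < 1) (hu : 1 < u) (hbu : b * u < 1)
    (hr : g + 1 ≤ (b + 1) * u)
    (hx : 0 < x) (hxu : x ≤ u) (hy : 0 < y) (hyx : y < x) (hyz : y ≤ z) (hxz : x < z)
    (hz : z * (b * y + x) = (b + 1) * u ^ 2 - (g + 1) * u + y + g * x)
    (hw : w * (b * z + y) = (b + 1) * u ^ 2 - (g + 1) * u + z + g * y)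
    (hn : 0 < x * z - (u ^ 2 - u) - y) :
    (1 + y) * (z - x) * (x * z - (u ^ 2 - u) - y) * w <
      (1 + z) * (w - y) * -(y * w - (u ^ 2 - u) - z) * x := by
  have hz0 : 0 < z := by linarith
  have hD : 0 < b * y + x := by positivity
  have hD' : 0 < b * z + y := by positivity
  have hA : 0 < u ^ 2 - u := by nlinarith
  have hN := lyness_defect b g u x y z hz
  have hN' := lyness_defect b g u y z w hw
  set A := u ^ 2 - u with hAdef
  set n := x * z - A - y with hndef
  set n' := y * w - A - z with hndef'
  have hnD : 0 < n * (b * y + x) := mul_pos hn hD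
  have hxw : x ≤ w := by
    have h1 : b * x < 1 := lt_of_le_of_lt (by gcongr) hbu
    have e : x * ((b * z + y) * (w - x)) = x * ((z - x) * (1 - b * x)) +
        (x - y) * (u * ((b + 1) * u - (g + 1)) + x * (1 - b * x)) +
        y * ((u - x) * ((b + 1) * (u + x) - (g + 1))) := by
      linear_combination x * hw
    have h2 : 0 ≤ x * ((b * z + y) * (w - x)) := by
      rw [e]
      have := mul_nonneg hx.le (mul_nonneg (sub_nonneg.2 hxz.le) (sub_nonneg.2 h1.le))
      have h3 : 0 ≤ u * ((b + 1) * u - (g + 1)) := mul_nonneg (by linarith) (by linarith)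
      have h4 : 0 ≤ x * (1 - b * x) := mul_nonneg hx.le (by linarith)
      have h5 : 0 ≤ (b + 1) * (u + x) - (g + 1) := by
        have : 0 < (b + 1) * x := by positivity
        linarith
      have h6 := mul_nonneg (sub_nonneg.2 hyx.le) (add_nonneg h3 h4)
      have h7 := mul_nonneg hy.le (mul_nonneg (sub_nonneg.2 hxu) h5)
      linarith
    have h3 := nonneg_of_mul_nonneg_right h2 hx
    linarith [nonneg_of_mul_nonneg_right h3 hD']
  have hw0 : 0 < w := by linarith
  have hweight : (z - x) * (x - y) * w < (w - y) * x * (z - y) := by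
    have : (w - y) * x * (z - y) - (z - x) * (x - y) * w =
        (w - x) * ((x - y) ^ 2 + y * (z - y)) + x * (x - y) ^ 2 := by ring
    have h1 : 0 < x * (x - y) ^ 2 := mul_pos hx (pow_pos (by linarith) 2)
    have h2 : 0 ≤ (w - x) * ((x - y) ^ 2 + y * (z - y)) :=
      mul_nonneg (by linarith) (add_nonneg (sq_nonneg _) (mul_nonneg hy.le (by linarith)))
    linarith
  have hbA : b * A ≤ x * z := by
    have e : (b * y + x) * (x * z - b * A) = (b * (x - y) * (x + y + A) + (g - b) * x * (x - u))
        + A * (x * (1 - b) + b * y * (1 - b)) + x * y + b * y ^ 2 := by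
      rw [hAdef]
      linear_combination x * hz
    have h1 : 0 < (b * y + x) * (x * z - b * A) := by
      rw [e, ← hN]
      have : 0 ≤ 1 - b := by linarith
      positivity
    linarith [pos_of_mul_pos_right h1 hD.le]
  have hfactor : (1 + y) * (x + y + A) * (b * z + y) ≤ (1 + z) * (b * y + x) * (z + y + A) := by
    have e : (1 + z) * (b * y + x) * (z + y + A) - (1 + y) * (x + y + A) * (b * z + y) =
        (z - y) * (x * z - b * A) + A * ((x - y) * (1 + y) + x * (z - y)) +
        b * z * y * (z - x) + (1 - b) * (z * (x - y) + y * (z - y)) +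
        y * (x * (z - y) + z * x - y ^ 2) := by ring
    have h1 := mul_nonneg (sub_nonneg.2 hyz) (sub_nonneg.2 hbA)
    have hzy := sub_nonneg.2 hyz
    have hxy := sub_pos.2 hyx
    have hzx := sub_pos.2 hxz
    have h2 : 0 ≤ A * ((x - y) * (1 + y) + x * (z - y)) := by positivity
    have h3 : 0 ≤ b * z * y * (z - x) := by positivity
    have h4 : 0 ≤ (1 - b) * (z * (x - y) + y * (z - y)) :=
      mul_nonneg (by linarith) (by positivity)
    have h5 : 0 ≤ y * (x * (z - y) + z * x - y ^ 2) :=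
      mul_nonneg hy.le (by nlinarith)
    linarith
  have hn1 : n * (b * y + x) ≤ b * (x - y) * (x + y + A) := by
    rw [hN]
    have : 0 ≤ (g - b) * x * (u - x) :=
      mul_nonneg (mul_nonneg (by linarith) hx.le) (by linarith)
    linarith
  have hn2 : b * (z - y) * (z + y + A) ≤ -n' * (b * z + y) := by
    have : 0 ≤ (g - b) * y * (u - y) :=
      mul_nonneg (mul_nonneg (by linarith) hy.le) (by linarith)
    linarith
  have hwy : 0 < w - y := by linarith
  have hzx := sub_pos.2 hxz
  have hzy : 0 < z - y := by linarith
  have hxy := sub_pos.2 hyx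
  refine lt_of_mul_lt_mul_right (a := (b * y + x) * (b * z + y)) ?_ (by positivity)
  calc (1 + y) * (z - x) * n * w * ((b * y + x) * (b * z + y))
      = ((1 + y) * (z - x) * w * (b * z + y)) * (n * (b * y + x)) := by ring
    _ ≤ ((1 + y) * (z - x) * w * (b * z + y)) * (b * (x - y) * (x + y + A)) := by gcongr
    _ = b * ((z - x) * (x - y) * w) * ((1 + y) * (x + y + A) * (b * z + y)) := by ring
    _ < b * ((w - y) * x * (z - y)) * ((1 + y) * (x + y + A) * (b * z + y)) := by gcongr
    _ ≤ b * ((w - y) * x * (z - y)) * ((1 + z) * (b * y + x) * (z + y + A)) := by gcongr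
    _ = ((1 + z) * (w - y) * x * (b * y + x)) * (b * (z - y) * (z + y + A)) := by ring
    _ ≤ ((1 + z) * (w - y) * x * (b * y + x)) * (-n' * (b * z + y)) := by gcongr
    _ = (1 + z) * (w - y) * -n' * x * ((b * y + x) * (b * z + y)) := by ring

lemma lower_descent (hb : 0 < b) (hgb : b < g) (hg1 : g < 1) (hu : 1 < u) (hbu : b * u < 1)
    (hr : g + 1 ≤ (b + 1) * u)
    (hx : 0 < x) (hy : 0 < y) (hxu : x ≤ u) (hyu : y ≤ u) (hne : x < u ∨ y < u)
    (hz : z * (b * y + x) = (b + 1) * u ^ 2 - (g + 1) * u + y + g * x)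
    (hw : w * (b * z + y) = (b + 1) * u ^ 2 - (g + 1) * u + z + g * y) :
    (1 + y) * (z - x) * (x * z - (u ^ 2 - u) - y) * w +
      (1 + z) * (w - y) * (y * w - (u ^ 2 - u) - z) * x < 0 := by
  have hyz := lower_le_next hb hu hbu hr hx hy hxu hyu hz
  obtain ⟨hyw, hyw'⟩ := lower_le_next_next hb hbu hr hy hyu hyz hw
  have hz0 : 0 < z := by linarith
  have hw0 : 0 < w := by linarith
  have hD : 0 < b * y + x := by positivity
  have hD' : 0 < b * z + y := by positivity
  have hA : 0 < u ^ 2 - u := by nlinarith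
  have hN := lyness_defect b g u x y z hz
  have hN' := lyness_defect b g u y z w hw
  have hgb' := sub_pos.2 hgb
  have hzy := sub_nonneg.2 hyz
  have hn'1 : 0 ≤ b * (z - y) * (y + z + (u ^ 2 - u)) := by positivity
  have hn' : y * w - (u ^ 2 - u) - z ≤ 0 := by
    have : 0 ≤ (g - b) * y * (u - y) := mul_nonneg (by positivity) (by linarith)
    exact nonpos_of_mul_nonpos_left (by linarith) hD'
  rcases hyu.eq_or_lt with rfl | hyu
  · have hxy : x < y := by simpa using hne
    have hn : x * z - (y ^ 2 - y) - y < 0 := by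
      have h1 : 0 < (g - b) * x * (y - x) := mul_pos (by positivity) (by linarith)
      have h2 : 0 < b * (y - x) * (x + y + (y ^ 2 - y)) :=
        mul_pos (mul_pos hb (by linarith)) (by linarith)
      exact neg_of_mul_neg_left (by linarith) hD.le
    have h1 : 0 < (1 + y) * (z - x) * w := mul_pos (mul_pos (by linarith) (by linarith)) hw0
    have h2 : 0 ≤ (1 + z) * (w - y) * x :=
      mul_nonneg (mul_nonneg (by linarith) (by linarith)) hx.le
    have h3 := mul_neg_of_pos_of_neg h1 hn
    have h4 := mul_nonpos_of_nonneg_of_nonpos h2 hn'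
    linarith
  · have hwy := sub_pos.2 (hyw' hyu)
    have hn'0 : y * w - (u ^ 2 - u) - z < 0 := by
      have : 0 < (g - b) * y * (u - y) := mul_pos (by positivity) (by linarith)
      exact neg_of_mul_neg_left (by linarith) hD'.le
    have hsecond : 0 < (1 + z) * (w - y) * -(y * w - (u ^ 2 - u) - z) * x :=
      mul_pos (mul_pos (by positivity) (by linarith)) hx
    rcases le_or_gt (x * z - (u ^ 2 - u) - y) 0 with hn | hn
    · rcases le_or_gt x z with hxz | hzx
      · have h1 : 0 ≤ (1 + y) * (z - x) * w :=
          mul_nonneg (mul_nonneg (by linarith) (by linarith)) hw0.le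
        have := mul_nonpos_of_nonneg_of_nonpos h1 hn
        linarith
      · have hyx : y < x := by linarith
        have h1 := lower_mul_le hb hu hr hx hy hxu hyx.le hyz hw
        have h2 := lower_defect_lt hb (hb.trans hgb) hy hyx hyz hz hw
        set n := x * z - (u ^ 2 - u) - y
        set n' := y * w - (u ^ 2 - u) - z
        have h3 : 0 ≤ -n := by linarith
        have h4 : 0 < (w - y) * x := by positivity
        have h5 : (x - z) * w ≤ (w - y) * x := by linarith
        have h6 : ((1 + y) * -n) * ((x - z) * w) < ((1 + z) * -n') * ((w - y) * x) :=
          calc ((1 + y) * -n) * ((x - z) * w) ≤ ((1 + y) * -n) * ((w - y) * x) := by gcongr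
            _ ≤ ((1 + z) * -n) * ((w - y) * x) := by gcongr
            _ < ((1 + z) * -n') * ((w - y) * x) := by gcongr
        linarith
    · rcases le_or_gt z x with hzx | hxz
      · have h1 : 0 ≤ (1 + y) * (x - z) * w :=
          mul_nonneg (mul_nonneg (by linarith) (by linarith)) hw0.le
        have := mul_nonneg h1 hn.le
        linarith
      · have hyx : y < x := by
          by_contra! hxy
          have h1 : 0 ≤ (g - b) * x * (u - x) := mul_nonneg (by positivity) (by linarith)
          have h2 : 0 ≤ b * (y - x) * (x + y + (u ^ 2 - u)) :=
            mul_nonneg (mul_nonneg hb.le (by linarith)) (by linarith)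
          have := mul_pos hn hD
          linarith
        have := lower_descent_of_lt hb hgb hg1 hu hbu hr hx hxu hy hyx hyz hxz hz hw hn
        linarith

end LowerQuadrant

section UpperQuadrant

variable {b g u x y z w : ℝ}

lemma upper_next_le (hb : 0 < b) (hu : 1 < u) (hg1 : g < 1) (hux : u ≤ x) (huy : u ≤ y)
    (hz : z * (b * y + x) = (b + 1) * u ^ 2 - (g + 1) * u + y + g * x) : z ≤ y := by
  have hy : 0 < y := by linarith
  have hby : 0 < b * y := by positivity
  have hbu : 0 < b * u := by positivity
  have e : (b * y + x) * (y - z) =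
      (b * y + x - (1 - b * u)) * (y - u) + (u - g) * (x - u) := by
    linear_combination -hz
  have h1 : 0 ≤ (b * y + x) * (y - z) := by
    rw [e]
    exact add_nonneg (mul_nonneg (by linarith) (by linarith))
      (mul_nonneg (by linarith) (by linarith))
  linarith [nonneg_of_mul_nonneg_right h1 (by linarith)]

lemma upper_next_next_le (hb : 0 < b) (hu : 1 < u) (hg1 : g < 1) (hbu : b * u < 1)
    (hr : g + 1 ≤ (b + 1) * u) (hux : u ≤ x) (huy : u ≤ y) (hz0 : 0 < z)
    (hz : z * (b * y + x) = (b + 1) * u ^ 2 - (g + 1) * u + y + g * x)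
    (hw : w * (b * z + y) = (b + 1) * u ^ 2 - (g + 1) * u + z + g * y) : w ≤ u := by
  have hy : 0 < y := by linarith
  have hx : 0 < x := by linarith
  have hby : 0 < b * y := by positivity
  have hbu0 : 0 < b * u := by positivity
  have hD : 0 < b * y + x := by positivity
  have hD' : 0 < b * z + y := by positivity
  have e : (b * y + x) * ((b * z + y) * (u - w)) =
      ((u - g) * (b * y + x) - (1 - b * u) ^ 2) * (y - u) +
        (1 - b * u) * (u - g) * (x - u) := by
    linear_combination -(b * y + x) * hw - (1 - b * u) * hz
  have h0 : 0 ≤ (u - g) * (b * y + x) - (1 - b * u) ^ 2 := by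
    have h1 : (1 - b * u) * (1 - b * u) ≤ (u - g) * (b * y + x) :=
      mul_le_mul (by linarith) (by linarith) (by linarith) (by linarith)
    linarith
  have h1 : 0 ≤ (b * y + x) * ((b * z + y) * (u - w)) := by
    rw [e]
    exact add_nonneg (mul_nonneg h0 (by linarith))
      (mul_nonneg (mul_nonneg (by linarith) (by linarith)) (by linarith))
  have h2 := nonneg_of_mul_nonneg_right h1 hD
  linarith [nonneg_of_mul_nonneg_right h2 hD']

/-- In the upper quadrant, the two-step product is dominated: `w x ≤ y z`. -/
lemma upper_mul_le (hb : 0 < b) (hg0 : 0 < g) (hg1 : g < 1) (hu : 1 < u) (hbu : b * u < 1)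
    (hr : g + 1 ≤ (b + 1) * u) (hux : u ≤ x) (hxy : x ≤ y) (hz0 : 0 < z)
    (hz : z * (b * y + x) = (b + 1) * u ^ 2 - (g + 1) * u + y + g * x)
    (hw : w * (b * z + y) = (b + 1) * u ^ 2 - (g + 1) * u + z + g * y) :
    w * x ≤ y * z := by
  have hy : 0 < y := by linarith
  have hx : 0 < x := by linarith
  have hu0 : 0 < u := by linarith
  have hD : 0 < b * y + x := by positivity
  have hD' : 0 < b * z + y := by positivity
  have hby : 0 < b * y := by positivity
  have hbz : 0 < b * z := by positivity
  have hbu0 : 0 < b * u := by positivity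
  have hη : 0 ≤ u - g := by linarith
  have hX := sub_nonneg.2 hux
  have hV := sub_nonneg.2 hxy
  have hY : 0 ≤ y - u := by linarith
  have hα : 0 ≤ 1 - b * u := by linarith
  have e : (b * z + y) * (y * z - w * x) =
      ((b * z + y) * y - x * (1 - b * u)) * (z - u) + (b * z + y) * u * (y - x) +
        x * ((u - g) * (y - u)) := by
    linear_combination -x * hw
  have hcoef : 0 ≤ (b * z + y) * y - x * (1 - b * u) := by
    have : x * (1 - b * u) ≤ y * (b * z + y) := by
      apply mul_le_mul hxy _ hα hy.le
      linarith
    linarith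
  have h1 : 0 ≤ (b * z + y) * (y * z - w * x) := by
    rcases le_or_gt u z with huz | hzu
    · rw [e]
      have := sub_nonneg.2 huz
      positivity
    · have hZ : (b * y + x) * (u - z) ≤ ((b + 1) * u - (g + 1)) * (x - u) := by
        have h2 : 0 ≤ (1 - b * u) * (y - x) := mul_nonneg hα hV
        linarith
      have he : 0 ≤ (b + 1) * u - (g + 1) := by linarith
      have hDD : b * z + y ≤ b * y + x + (y - x) := by
        have : b * z ≤ b * y := by
          gcongr
          linarith
        linarith
      have h3 : 0 ≤ (b * y + x) * ((b * z + y) * (y * z - w * x)) := by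
        have h4 : (((b * z + y) * y - x * (1 - b * u))) * ((b * y + x) * (u - z)) ≤
            ((b * z + y) * y) * (((b + 1) * u - (g + 1)) * (x - u)) := by
          apply mul_le_mul _ hZ (mul_nonneg hD.le (by linarith)) (by positivity)
          have := mul_nonneg hx.le hα
          linarith
        have h5 : (b * z + y) * x * (((b + 1) * u - (g + 1)) * (x - u)) ≤
            (b * y + x + (y - x)) * x * (((b + 1) * u - (g + 1)) * (x - u)) := by gcongr
        have h6 : ((b + 1) * u - (g + 1)) * ((b * y + x) * x * (x - u)) ≤
            (u - g) * ((b * y + x) * x * (x - u)) := by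
          apply mul_le_mul_of_nonneg_right (by linarith) (by positivity)
        have h7 : (((b + 1) * u - (g + 1)) * (x - u)) * (x * (y - x)) ≤
            ((u - g) * (b * y + x)) * (x * (y - x)) := by
          apply mul_le_mul_of_nonneg_right _ (by positivity)
          exact mul_le_mul (by linarith) (by linarith) hX hη
        have h8 : (((b + 1) * u - (g + 1)) * (x - u)) * ((b * z + y) * (y - x)) ≤
            (u * (b * y + x)) * ((b * z + y) * (y - x)) := by
          apply mul_le_mul_of_nonneg_right _ (by positivity)
          exact mul_le_mul (by linarith) (by linarith) hX hu0.le
        rw [e]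
        linarith
      exact nonneg_of_mul_nonneg_right h3 hD
  linarith [nonneg_of_mul_nonneg_right h1 hD']

lemma upper_descent_of_lt (hb : 0 < b) (hgb : b < g) (hg1 : g < 1) (hu : 1 < u)
    (hbu : b * u < 1) (hr : g + 1 ≤ (b + 1) * u) (hux : u ≤ x) (hxy : x < y)
    (hzx : z < x) (hz0 : 0 < z) (hw0 : 0 < w)
    (hz : z * (b * y + x) = (b + 1) * u ^ 2 - (g + 1) * u + y + g * x)
    (hw : w * (b * z + y) = (b + 1) * u ^ 2 - (g + 1) * u + z + g * y) :
    (1 + y) * (x - z) * -(x * z - (u ^ 2 - u) - y) * w <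
      (1 + z) * (y - w) * (y * w - (u ^ 2 - u) - z) * x := by
  have hy : 0 < y := by linarith
  have hx : 0 < x := by linarith
  have hg0 : 0 < g := by linarith
  have hD : 0 < b * y + x := by positivity
  have hD' : 0 < b * z + y := by positivity
  have hA : 0 < u ^ 2 - u := by nlinarith
  have hN := lyness_defect b g u x y z hz
  have hN' := lyness_defect b g u y z w hw
  have hwu := upper_next_next_le hb hu hg1 hbu hr hux (by linarith) hz0 hz hw
  have hmul := upper_mul_le hb hg0 hg1 hu hbu hr hux hxy.le hz0 hz hw
  have hgb' := sub_pos.2 hgb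
  have hxz := sub_pos.2 hzx
  have hyw : 0 < y - w := by linarith
  have hdef : -(x * z - (u ^ 2 - u) - y) * (b * y + x) <
      (y * w - (u ^ 2 - u) - z) * (b * z + y) := by
    have h1 : 0 ≤ (g - b) * x * (x - u) := mul_nonneg (by positivity) (by linarith)
    have h2 : 0 ≤ (g - b) * y * (y - u) := mul_nonneg (by positivity) (by linarith)
    have h3 : 0 < b * (x - z) * (x + z + (u ^ 2 - u)) := by positivity
    linarith
  have hrat : (1 + y) * (w * (b * z + y)) ≤ (1 + z) * (y * (b * y + x)) := by
    have h1 : 0 ≤ z * ((1 + z) * (y * (b * y + x)) - (1 + y) * (w * (b * z + y))) := by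
      have e : z * ((1 + z) * (y * (b * y + x)) - (1 + y) * (w * (b * z + y))) =
          (u * ((b + 1) * u - (g + 1))) * (y - z) + (y - z) * (y + z) +
            g * y * (x - z) + y * z * ((1 - g) * (y - x) + (x - z)) := by
        linear_combination (1 + z) * y * hz - (1 + y) * z * hw
      have h2 : 0 ≤ u * ((b + 1) * u - (g + 1)) := mul_nonneg (by linarith) (by linarith)
      have h3 : 0 ≤ y - z := by linarith
      have h4 : 0 ≤ 1 - g := by linarith
      have h5 := sub_nonneg.2 hxy.le
      rw [e]
      positivity
    linarith [nonneg_of_mul_nonneg_right h1 hz0]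
  set n := x * z - (u ^ 2 - u) - y
  set n' := y * w - (u ^ 2 - u) - z
  have hn' : 0 < n' := by
    have h2 : 0 ≤ (g - b) * y * (y - u) := mul_nonneg (by positivity) (by linarith)
    have h3 : 0 < b * (y - z) * (y + z + (u ^ 2 - u)) :=
      mul_pos (mul_pos hb (by linarith)) (by linarith)
    have h4 : 0 < n' * (b * z + y) := by linarith
    exact pos_of_mul_pos_left h4 hD'.le
  have hmul' : (x - z) * y ≤ (y - w) * x := by linarith
  refine lt_of_mul_lt_mul_right (a := y * (b * y + x) * (b * z + y)) ?_ (by positivity)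
  calc (1 + y) * (x - z) * -n * w * (y * (b * y + x) * (b * z + y))
      = ((1 + y) * (w * (b * z + y))) * ((x - z) * y) * (-n * (b * y + x)) := by ring
    _ < ((1 + y) * (w * (b * z + y))) * ((x - z) * y) * (n' * (b * z + y)) := by gcongr
    _ ≤ ((1 + y) * (w * (b * z + y))) * ((y - w) * x) * (n' * (b * z + y)) := by gcongr
    _ ≤ ((1 + z) * (y * (b * y + x))) * ((y - w) * x) * (n' * (b * z + y)) := by gcongr
    _ = (1 + z) * (y - w) * n' * x * (y * (b * y + x) * (b * z + y)) := by ring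

lemma upper_descent_of_gt (hb : 0 < b) (hgb : b < g) (hg1 : g < 1) (hu : 1 < u)
    (hbu : b * u < 1) (hr : g + 1 ≤ (b + 1) * u) (hux : u ≤ x) (hxz : x < z)
    (hzy : z ≤ y) (hw0 : 0 < w)
    (hz : z * (b * y + x) = (b + 1) * u ^ 2 - (g + 1) * u + y + g * x)
    (hw : w * (b * z + y) = (b + 1) * u ^ 2 - (g + 1) * u + z + g * y) :
    (1 + y) * (z - x) * (x * z - (u ^ 2 - u) - y) * w <
      (1 + z) * (y - w) * (y * w - (u ^ 2 - u) - z) * x := by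
  have hy : 0 < y := by linarith
  have hx : 0 < x := by linarith
  have hz0 : 0 < z := by linarith
  have hg0 : 0 < g := by linarith
  have hby : 0 < b * y := by positivity
  have hbu0 : 0 < b * u := by positivity
  have hD : 0 < b * y + x := by positivity
  have hD' : 0 < b * z + y := by positivity
  have hA : 0 < u ^ 2 - u := by nlinarith
  have hN := lyness_defect b g u x y z hz
  have hN' := lyness_defect b g u y z w hw
  have hwu := upper_next_next_le hb hu hg1 hbu hr hux (by linarith) hz0 hz hw
  have hgb' := sub_pos.2 hgb
  have hzx := sub_pos.2 hxz
  have hY : 0 < y - u := by linarith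
  have hyw : y - u ≤ y - w := by linarith
  have hX : 0 ≤ x - u := by linarith
  have hη : 0 < u - g := by linarith
  have hn1 : (x * z - (u ^ 2 - u) - y) * (b * y + x) < (g - b) * x * (x - u) := by
    have : 0 < b * (y - x) * (x + y + (u ^ 2 - u)) :=
      mul_pos (mul_pos hb (by linarith)) (by linarith)
    linarith
  have hn2 : (g - b) * y * (y - u) ≤ (y * w - (u ^ 2 - u) - z) * (b * z + y) := by
    have : 0 ≤ b * (y - z) * (y + z + (u ^ 2 - u)) :=
      mul_nonneg (mul_nonneg hb.le (by linarith)) (by linarith)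
    linarith
  have hstep : (z - x) * (b * y + x) ≤ (y - u) - (b * y + x + (u - g)) * (x - u) := by
    have : 0 ≤ b * u * (y - u) := by positivity
    linarith
  have hM : w * (b * z + y) ≤ 2 * (b * y + x + (u - g)) * (b * y + x) ^ 2 * (1 + z) := by
    have hD1 : 1 ≤ b * y + x := by linarith
    have hDu : u ≤ (b * y + x) ^ 2 := by nlinarith
    have hzD : y ≤ z * (b * y + x) := by
      have h2 : 0 ≤ u * ((b + 1) * u - (g + 1)) := mul_nonneg (by linarith) (by linarith)
      have h3 : 0 < g * x := by positivity
      linarith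
    have h1 : u * (u - g) ≤ (b * y + x) ^ 2 * (u - g) := by gcongr
    have h2 : 0 ≤ u * (1 - b * u) := mul_nonneg (by linarith) (by linarith)
    have h3 : z * (b * y + x) ≤ z * (b * y + x) * (b * y + x) ^ 2 :=
      le_mul_of_one_le_right (by positivity) (one_le_pow₀ hD1)
    have h4 : g * y ≤ 1 * y := by gcongr
    have h5 : z ≤ z * (b * y + x) := le_mul_of_one_le_right hz0.le hD1
    have h6 : 0 ≤ (u - g) * (b * y + x) ^ 2 * (1 + 2 * z) := by positivity
    have h7 : 0 ≤ (b * y + x) * (b * y + x) ^ 2 := by positivity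
    linarith
  set D := b * y + x
  set D' := b * z + y
  set n := x * z - (u ^ 2 - u) - y
  set n' := y * w - (u ^ 2 - u) - z
  set c := D + (u - g)
  have hc : 0 < c := by positivity
  have hquad : 4 * c * (((y - u) - c * (x - u)) * (x - u)) ≤ (y - u) ^ 2 := by
    linarith [sq_nonneg (y - u - 2 * c * (x - u))]
  have hpos : 0 ≤ (y - u) - c * (x - u) := le_trans (by positivity) hstep
  have hy1 : 1 + y ≤ 2 * y := by linarith
  have hyw0 : 0 ≤ y - w := by linarith
  refine lt_of_mul_lt_mul_right (a := D * D * D') ?_ (by positivity)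
  calc (1 + y) * (z - x) * n * w * (D * D * D')
      = (1 + y) * ((z - x) * D) * (w * D') * (n * D) := by ring
    _ < (1 + y) * ((z - x) * D) * (w * D') * ((g - b) * x * (x - u)) := by gcongr
    _ ≤ (2 * y) * ((y - u) - c * (x - u)) * (2 * c * D ^ 2 * (1 + z)) *
          ((g - b) * x * (x - u)) := by gcongr
    _ = (g - b) * x * y * D ^ 2 * (1 + z) *
          (4 * c * (((y - u) - c * (x - u)) * (x - u))) := by ring
    _ ≤ (g - b) * x * y * D ^ 2 * (1 + z) * (y - u) ^ 2 := by gcongr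
    _ = (1 + z) * (y - u) * D ^ 2 * x * ((g - b) * y * (y - u)) := by ring
    _ ≤ (1 + z) * (y - w) * D ^ 2 * x * (n' * D') := by gcongr
    _ = (1 + z) * (y - w) * n' * x * (D * D * D') := by ring

lemma upper_descent (hb : 0 < b) (hgb : b < g) (hg1 : g < 1) (hu : 1 < u) (hbu : b * u < 1)
    (hr : g + 1 ≤ (b + 1) * u)
    (hux : u ≤ x) (huy : u ≤ y) (hne : u < x ∨ u < y) (hz0 : 0 < z) (hw0 : 0 < w)
    (hz : z * (b * y + x) = (b + 1) * u ^ 2 - (g + 1) * u + y + g * x)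
    (hw : w * (b * z + y) = (b + 1) * u ^ 2 - (g + 1) * u + z + g * y) :
    (1 + y) * (z - x) * (x * z - (u ^ 2 - u) - y) * w +
      (1 + z) * (w - y) * (y * w - (u ^ 2 - u) - z) * x < 0 := by
  have hzy := upper_next_le hb hu hg1 hux huy hz
  have hwu := upper_next_next_le hb hu hg1 hbu hr hux huy hz0 hz hw
  have hx : 0 < x := by linarith
  have hy : 0 < y := by linarith
  have hD : 0 < b * y + x := by positivity
  have hD' : 0 < b * z + y := by positivity
  have hA : 0 < u ^ 2 - u := by nlinarith
  have hN := lyness_defect b g u x y z hz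
  have hN' := lyness_defect b g u y z w hw
  have hgb' := sub_pos.2 hgb
  have hyz := sub_nonneg.2 hzy
  have hn'1 : 0 ≤ b * (y - z) * (y + z + (u ^ 2 - u)) := by positivity
  have hn' : 0 ≤ y * w - (u ^ 2 - u) - z := by
    have : 0 ≤ (g - b) * y * (y - u) := mul_nonneg (by positivity) (by linarith)
    exact nonneg_of_mul_nonneg_left (by linarith) hD'
  rcases huy.eq_or_lt with rfl | huy
  · have hxu : u < x := by simpa using hne
    have hn : 0 < x * z - (u ^ 2 - u) - u := by
      have h1 : 0 < (g - b) * x * (x - u) := mul_pos (by positivity) (by linarith)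
      have h2 : 0 < b * (x - u) * (x + u + (u ^ 2 - u)) :=
        mul_pos (mul_pos hb (by linarith)) (by linarith)
      exact pos_of_mul_pos_left (by linarith) hD.le
    have h1 : 0 < (1 + u) * (x - z) * w := mul_pos (mul_pos (by linarith) (by linarith)) hw0
    have h2 : 0 ≤ (1 + z) * (u - w) * x :=
      mul_nonneg (mul_nonneg (by linarith) (by linarith)) hx.le
    have h3 := mul_pos h1 hn
    have h4 := mul_nonneg h2 hn'
    linarith
  · have hyw : 0 < y - w := by linarith
    have hn'0 : 0 < y * w - (u ^ 2 - u) - z := by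
      have : 0 < (g - b) * y * (y - u) := mul_pos (by positivity) (by linarith)
      exact pos_of_mul_pos_left (by linarith) hD'.le
    have hsecond : 0 < (1 + z) * (y - w) * (y * w - (u ^ 2 - u) - z) * x := by positivity
    rcases le_or_gt (x * z - (u ^ 2 - u) - y) 0 with hn | hn
    · rcases le_or_gt x z with hxz | hzx
      · have h1 : 0 ≤ (1 + y) * (z - x) * w :=
          mul_nonneg (mul_nonneg (by linarith) (by linarith)) hw0.le
        have := mul_nonpos_of_nonneg_of_nonpos h1 hn
        linarith
      · rcases le_or_gt y x with hyx | hxy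
        · have h1 : 0 ≤ (g - b) * x * (x - u) := mul_nonneg (by positivity) (by linarith)
          have h2 : 0 ≤ b * (x - y) * (x + y + (u ^ 2 - u)) :=
            mul_nonneg (mul_nonneg hb.le (by linarith)) (by linarith)
          have h3 : 0 ≤ x * z - (u ^ 2 - u) - y :=
            nonneg_of_mul_nonneg_left (by linarith) hD
          rw [le_antisymm hn h3]
          linarith
        · have := upper_descent_of_lt hb hgb hg1 hu hbu hr hux hxy hzx hz0 hw0 hz hw
          linarith
    · rcases le_or_gt z x with hzx | hxz
      · have h1 : 0 ≤ (1 + y) * (x - z) * w :=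
          mul_nonneg (mul_nonneg (by linarith) (by linarith)) hw0.le
        have := mul_nonneg h1 hn.le
        linarith
      · have := upper_descent_of_gt hb hgb hg1 hu hbu hr hux hxz hzy hw0 hz hw
        linarith

end UpperQuadrant

/-- Claim (case `g > b`): on the quadrants `Q₁(u,u) ∪ Q₃(u,u)` (minus `(u,u)`), the Lyness invariant `G` strictly decreases along two steps of the map `T`. -/
theorem stmt_14 (b g u : ℝ)
    (hb0 : 0 < b) (hb1 : b < 1) (hg0 : 0 < g) (hg1 : g < 1)
    (hu1 : 1 < u) (hub : u < 1 / b) (hgu : (g + 1) / (b + 1) ≤ u)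
    (hgb : b < g)
    (T : ℝ × ℝ → ℝ × ℝ)
    (hT : ∀ P : ℝ × ℝ, T P =
      (P.2, ((b + 1) * u ^ 2 - (g + 1) * u + P.2 + g * P.1) / (b * P.2 + P.1)))
    (G : ℝ × ℝ → ℝ)
    (hG : ∀ P : ℝ × ℝ, G P = (1 + P.1) * (1 + P.2) * (u ^ 2 - u + P.1 + P.2) / (P.1 * P.2))
    (x y : ℝ) (hx : 0 < x) (hy : 0 < y)
    (hQ : (u ≤ x ∧ u ≤ y) ∨ (x ≤ u ∧ y ≤ u))
    (hne : (x, y) ≠ (u, u)) :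
    G (T (T (x, y))) < G (x, y) := by
  have hbu : b * u < 1 := by rwa [lt_div_iff₀ hb0, mul_comm] at hub
  have hr : g + 1 ≤ (b + 1) * u := by rwa [div_le_iff₀ (by linarith), mul_comm] at hgu
  have hr' : 0 ≤ (b + 1) * u ^ 2 - (g + 1) * u := by
    have : 0 ≤ u * ((b + 1) * u - (g + 1)) := mul_nonneg (by linarith) (by linarith)
    linarith
  simp only [hT, hG]
  set z := ((b + 1) * u ^ 2 - (g + 1) * u + y + g * x) / (b * y + x) with hzdef
  have hz0 : 0 < z := by positivity
  set w := ((b + 1) * u ^ 2 - (g + 1) * u + z + g * y) / (b * z + y) with hwdef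
  have hw0 : 0 < w := by positivity
  have hz : z * (b * y + x) = (b + 1) * u ^ 2 - (g + 1) * u + y + g * x :=
    div_mul_cancel₀ _ (by positivity)
  have hw : w * (b * z + y) = (b + 1) * u ^ 2 - (g + 1) * u + z + g * y :=
    div_mul_cancel₀ _ (by positivity)
  have hdescent : (1 + y) * (z - x) * (x * z - (u ^ 2 - u) - y) * w +
      (1 + z) * (w - y) * (y * w - (u ^ 2 - u) - z) * x < 0 := by
    rcases hQ with ⟨hux, huy⟩ | ⟨hxu, hyu⟩
    · refine upper_descent hb0 hgb hg1 hu1 hbu hr hux huy ?_ hz0 hw0 hz hw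
      by_contra! h
      exact hne (Prod.ext (le_antisymm h.1 hux) (le_antisymm h.2 huy))
    · refine lower_descent hb0 hgb hg1 hu1 hbu hr hx hy hxu hyu ?_ hz hw
      by_contra! h
      exact hne (Prod.ext (le_antisymm hxu h.1) (le_antisymm hyu h.2))
  have h1 := lyness_invariant_sub (u ^ 2 - u) x y z hx.ne' hy.ne' hz0.ne'
  have h2 := lyness_invariant_sub (u ^ 2 - u) y z w hy.ne' hz0.ne' hw0.ne'
  have h3 : (1 + y) * (z - x) * (x * z - (u ^ 2 - u) - y) / (x * y * z) +
      (1 + z) * (w - y) * (y * w - (u ^ 2 - u) - z) / (y * z * w) =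
      ((1 + y) * (z - x) * (x * z - (u ^ 2 - u) - y) * w +
        (1 + z) * (w - y) * (y * w - (u ^ 2 - u) - z) * x) / (x * y * z * w) := by
    field_simp
  have h4 := div_neg_of_neg_of_pos hdescent (by positivity : 0 < x * y * z * w)
  linarith
end

section
/- Let b, g, u be real numbers with 0 < b < 1, 0 < g < 1, 1 < u < 1/b, (g+1)/(b+1) ≤ u, and g < b. Define T : (0,∞)² → (0,∞)² by T(x,y) = (y, ((b+1)u² − (g+1)u + y + g·x)/(b·y + x)), and define G(x,y) = (1+x)(1+y)(u² − u + x + y)/(x·y). Suppose x, y > 0 satisfy either (u ≤ x and u ≤ y) or (x ≤ u and y ≤ u), and (x,y) ≠ (u,u). Then G(T(T(T(x,y)))) < G(x,y). -/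
/-- Polynomial expressions in `m` variables with coefficients in `ℕ`. -/
inductive PolyExpr (m : ℕ) : Type
  | one : PolyExpr m
  | var : Fin m → PolyExpr m
  | add : PolyExpr m → PolyExpr m → PolyExpr m
  | mul : PolyExpr m → PolyExpr m → PolyExpr m

namespace PolyExpr

variable {m : ℕ}

instance : One (PolyExpr m) := ⟨one⟩
instance : Add (PolyExpr m) := ⟨add⟩
instance : Mul (PolyExpr m) := ⟨mul⟩

/-- The value of a polynomial expression at a point. -/
def eval {R : Type*} [CommSemiring R] (ρ : Fin m → R) : PolyExpr m → R
  | one => 1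
  | var i => ρ i
  | add a b => a.eval ρ + b.eval ρ
  | mul a b => a.eval ρ * b.eval ρ

@[simp] theorem eval_one {R : Type*} [CommSemiring R] (ρ : Fin m → R) :
    (1 : PolyExpr m).eval ρ = 1 := rfl

@[simp] theorem eval_var {R : Type*} [CommSemiring R] (ρ : Fin m → R) (i : Fin m) :
    (var i).eval ρ = ρ i := rfl

@[simp] theorem eval_add {R : Type*} [CommSemiring R] (ρ : Fin m → R) (a b : PolyExpr m) :
    (a + b).eval ρ = a.eval ρ + b.eval ρ := rfl

@[simp] theorem eval_mul {R : Type*} [CommSemiring R] (ρ : Fin m → R) (a b : PolyExpr m) :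
    (a * b).eval ρ = a.eval ρ * b.eval ρ := rfl

/-- The polynomial denoted by an expression. -/
noncomputable def toMvPolynomial (e : PolyExpr m) : MvPolynomial (Fin m) ℕ :=
  e.eval MvPolynomial.X

theorem aeval_toMvPolynomial {R : Type*} [CommSemiring R] (ρ : Fin m → R) (e : PolyExpr m) :
    MvPolynomial.aeval ρ e.toMvPolynomial = e.eval ρ := by
  unfold toMvPolynomial
  induction e with
  | one => simp [eval]
  | var i => simp [eval]
  | add a b ha hb => simp [eval, ha, hb]
  | mul a b ha hb => simp [eval, ha, hb]

/-- An upper bound for the degree of an expression in the `i`-th variable. -/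
def degBound (i : Fin m) : PolyExpr m → ℕ
  | one => 0
  | var j => if i = j then 1 else 0
  | add a b => max (a.degBound i) (b.degBound i)
  | mul a b => a.degBound i + b.degBound i

theorem degreeOf_toMvPolynomial_le (i : Fin m) (e : PolyExpr m) :
    e.toMvPolynomial.degreeOf i ≤ e.degBound i := by
  unfold toMvPolynomial
  induction e with
  | one => simp [eval, degBound]
  | var j => simp [eval, degBound, MvPolynomial.degreeOf_X]
  | add a b ha hb => exact (MvPolynomial.degreeOf_add_le _ _ _).trans (max_le_max ha hb)
  | mul a b ha hb => exact (MvPolynomial.degreeOf_mul_le _ _ _).trans (add_le_add ha hb)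

/-- The exponent vector with entries `f i`. -/
noncomputable def exponents {D : Fin m → ℕ} (f : ∀ i, Fin (D i)) : Fin m →₀ ℕ :=
  Finsupp.equivFunOnFinite.symm fun i => (f i : ℕ)

theorem eval_eq_sum {R : Type*} [CommSemiring R] (ρ : Fin m → R) {D : Fin m → ℕ}
    {e : PolyExpr m} (h : ∀ i, e.degBound i < D i) :
    e.eval ρ = ∑ f : ∀ i, Fin (D i),
      ((e.toMvPolynomial.coeff (exponents f) : ℕ) : R) * ∏ i, ρ i ^ (f i : ℕ) := by
  have hinj : Function.Injective (exponents (D := D)) := by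
    intro f f' hff
    funext i
    exact Fin.ext (DFunLike.congr_fun hff i)
  rw [← aeval_toMvPolynomial, MvPolynomial.aeval_def, MvPolynomial.eval₂_eq']
  have hsub : e.toMvPolynomial.support ⊆ Finset.univ.map ⟨exponents (D := D), hinj⟩ := by
    intro d hd
    have hlt : ∀ i, d i < D i := fun i =>
      ((MvPolynomial.monomial_le_degreeOf i hd).trans
        (degreeOf_toMvPolynomial_le i e)).trans_lt (h i)
    simp only [Finset.mem_map, Finset.mem_univ, true_and, Function.Embedding.coeFn_mk]
    exact ⟨fun i => ⟨d i, hlt i⟩, Finsupp.ext fun i => rfl⟩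
  rw [Finset.sum_subset hsub, Finset.sum_map]
  · refine Finset.sum_congr rfl fun f _ => ?_
    simp [exponents]
  · intro d _ hd
    simp [MvPolynomial.notMem_support_iff.mp hd]

theorem coeff_le_eval_one {D : Fin m → ℕ} {e : PolyExpr m} (h : ∀ i, e.degBound i < D i)
    (f : ∀ i, Fin (D i)) :
    e.toMvPolynomial.coeff (exponents f) ≤ e.eval fun _ => 1 := by
  rw [eval_eq_sum _ h]
  simpa using Finset.single_le_sum
    (f := fun f : ∀ i, Fin (D i) => e.toMvPolynomial.coeff (exponents f))
    (fun _ _ => Nat.zero_le _) (Finset.mem_univ f)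

theorem eval_kronecker {D w : Fin m → ℕ} {e : PolyExpr m} (h : ∀ i, e.degBound i < D i)
    (hw : ∀ i, w i = ∏ j, D (Fin.castLE i.is_lt.le j)) (N : ℕ) :
    (e.eval fun i => N ^ w i) =
      ∑ j : Fin (∏ i, D i), e.toMvPolynomial.coeff (exponents (finPiFinEquiv.symm j)) *
        N ^ (j : ℕ) := by
  rw [eval_eq_sum _ h, ← Equiv.sum_comp finPiFinEquiv]
  refine Finset.sum_congr rfl fun f _ => ?_
  rw [Equiv.symm_apply_apply, finPiFinEquiv_apply, ← Finset.prod_pow_eq_pow_sum]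
  congr 1
  refine Finset.prod_congr rfl fun i _ => ?_
  rw [← hw, ← pow_mul, mul_comm]

end PolyExpr

theorem Nat.testBit_sum_mul_two_pow_pow (κ : ℕ) {r : ℕ} (hr : r < κ) {n : ℕ} {d : ℕ → ℕ}
    (hd : ∀ j < n, d j < 2 ^ κ) {j : ℕ} (hj : j < n) :
    (∑ i ∈ Finset.range n, d i * (2 ^ κ) ^ i).testBit (κ * j + r) = (d j).testBit r := by
  induction n generalizing d j with
  | zero => omega
  | succ n ih =>
    have hsum : ∑ i ∈ Finset.range (n + 1), d i * (2 ^ κ) ^ i =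
        2 ^ κ * (∑ i ∈ Finset.range n, d (i + 1) * (2 ^ κ) ^ i) + d 0 := by
      rw [Finset.sum_range_succ', Finset.mul_sum, pow_zero, mul_one]
      congr 1
      exact Finset.sum_congr rfl fun i _ => by ring
    rw [hsum, Nat.testBit_two_pow_mul_add _ (hd 0 n.succ_pos)]
    cases j with
    | zero => simp [hr]
    | succ j =>
      have hle : ¬ κ * (j + 1) + r < κ := by rw [mul_add]; omega
      have hsub : κ * (j + 1) + r - κ = κ * j + r := by rw [mul_add]; omega
      rw [if_neg hle, hsub]
      exact ih (d := fun i => d (i + 1)) (fun i hi => hd _ (by omega)) (by omega)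

theorem Nat.le_of_land_sum_eq (κ : ℕ) {n : ℕ} {c c' : ℕ → ℕ} (hc : ∀ j < n, c j < 2 ^ κ)
    (hc' : ∀ j < n, c' j < 2 ^ κ)
    (h : (∑ j ∈ Finset.range n, c j * (2 ^ (κ + 1)) ^ j +
        2 ^ κ * ∑ j ∈ Finset.range n, (2 ^ (κ + 1)) ^ j -
        ∑ j ∈ Finset.range n, c' j * (2 ^ (κ + 1)) ^ j) &&&
        (2 ^ κ * ∑ j ∈ Finset.range n, (2 ^ (κ + 1)) ^ j) =
        2 ^ κ * ∑ j ∈ Finset.range n, (2 ^ (κ + 1)) ^ j) {j : ℕ} (hj : j < n) :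
    c' j ≤ c j := by
  have hpow : 2 ^ (κ + 1) = 2 ^ κ + 2 ^ κ := by ring
  have hdiff : ∑ j ∈ Finset.range n, c j * (2 ^ (κ + 1)) ^ j +
        2 ^ κ * ∑ j ∈ Finset.range n, (2 ^ (κ + 1)) ^ j -
        ∑ j ∈ Finset.range n, c' j * (2 ^ (κ + 1)) ^ j =
      ∑ j ∈ Finset.range n, (c j + 2 ^ κ - c' j) * (2 ^ (κ + 1)) ^ j := by
    rw [Nat.sub_eq_iff_eq_add', Finset.mul_sum, ← Finset.sum_add_distrib,
      ← Finset.sum_add_distrib]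
    · refine Finset.sum_congr rfl fun i hi => ?_
      have := hc' i (Finset.mem_range.mp hi)
      rw [← add_mul, ← add_mul]
      congr 1
      omega
    · refine le_trans ?_ (Nat.le_add_left _ _)
      rw [Finset.mul_sum]
      exact Finset.sum_le_sum fun i hi =>
        Nat.mul_le_mul_right _ (hc' i (Finset.mem_range.mp hi)).le
  have htop : (2 ^ κ * ∑ j ∈ Finset.range n, (2 ^ (κ + 1)) ^ j).testBit ((κ + 1) * j + κ) =
      true := by
    rw [Finset.mul_sum, Nat.testBit_sum_mul_two_pow_pow (κ + 1) κ.lt_succ_self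
      (d := fun _ => 2 ^ κ) (fun _ _ => by rw [hpow]; have := Nat.two_pow_pos κ; omega) hj]
    exact Nat.testBit_two_pow_self
  rw [← h, Nat.testBit_land, Bool.and_eq_true, hdiff,
    Nat.testBit_sum_mul_two_pow_pow (κ + 1) κ.lt_succ_self
      (d := fun i => c i + 2 ^ κ - c' i) (fun i hi => ?_) hj] at htop
  · have := Nat.ge_two_pow_of_testBit htop.1
    have := hc' j hj
    omega
  · have := hc i hi
    omega

namespace PolyExpr

variable {m : ℕ}

/-- A test, by Kronecker substitution, that every coefficient of `e'` is at most the corresponding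
coefficient of `e`: both are evaluated at powers of `2 ^ (κ + 1)`, so that their coefficients are
digits of the results, which are then compared bitwise. -/
def coeffLE (κ : ℕ) (D w : Fin m → ℕ) (n : ℕ) (e e' : PolyExpr m) : Bool :=
  (List.finRange m).all (fun i => e.degBound i < D i && e'.degBound i < D i) &&
  decide ((e.eval fun _ => 1) < 2 ^ κ) && decide ((e'.eval fun _ => 1) < 2 ^ κ) &&
  Nat.beq (Nat.land ((e.eval fun i => 2 ^ ((κ + 1) * w i)) +
      2 ^ κ * (((2 ^ (κ + 1)) ^ n - 1) / (2 ^ (κ + 1) - 1)) -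
      (e'.eval fun i => 2 ^ ((κ + 1) * w i)))
    (2 ^ κ * (((2 ^ (κ + 1)) ^ n - 1) / (2 ^ (κ + 1) - 1))))
    (2 ^ κ * (((2 ^ (κ + 1)) ^ n - 1) / (2 ^ (κ + 1) - 1)))

theorem eval_le_eval_of_coeffLE {κ : ℕ} {D w : Fin m → ℕ} {n : ℕ} {e e' : PolyExpr m}
    (hw : ∀ i, w i = ∏ j, D (Fin.castLE i.is_lt.le j)) (hn : ∏ i, D i = n)
    (h : coeffLE κ D w n e e' = true) {ρ : Fin m → ℝ} (hρ : ∀ i, 0 ≤ ρ i) :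
    e'.eval ρ ≤ e.eval ρ := by
  simp only [coeffLE, Bool.and_eq_true, List.all_eq_true, List.mem_finRange,
    decide_eq_true_eq, pow_mul, forall_const] at h
  obtain ⟨⟨⟨hdeg, h1⟩, h1'⟩, hbit⟩ := h
  have hd : ∀ i, e.degBound i < D i := fun i => (hdeg i).1
  have hd' : ∀ i, e'.degBound i < D i := fun i => (hdeg i).2
  have hbit := Nat.eq_of_beq_eq_true hbit
  subst hn
  rw [← Nat.geomSum_eq (by have := Nat.one_lt_two_pow (n := κ + 1) (by omega); omega),
    eval_kronecker hd hw, eval_kronecker hd' hw] at hbit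
  let c : PolyExpr m → ℕ → ℕ := fun e j =>
    if hj : j < ∏ i, D i then
      e.toMvPolynomial.coeff (exponents (finPiFinEquiv.symm (⟨j, hj⟩ : Fin (∏ i, D i)))) else 0
  have hc : ∀ (e : PolyExpr m) (j : Fin (∏ i, D i)),
      e.toMvPolynomial.coeff (exponents (finPiFinEquiv.symm j)) = c e j := by
    intro e j
    simp [c]
  have hsum : ∀ e : PolyExpr m, ∑ j : Fin (∏ i, D i),
      e.toMvPolynomial.coeff (exponents (finPiFinEquiv.symm j)) * (2 ^ (κ + 1)) ^ (j : ℕ) =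
      ∑ j ∈ Finset.range (∏ i, D i), c e j * (2 ^ (κ + 1)) ^ j := by
    intro e
    simp only [hc]
    exact Fin.sum_univ_eq_sum_range (fun j => c e j * (2 ^ (κ + 1)) ^ j) _
  rw [hsum, hsum] at hbit
  have hle : ∀ f : ∀ i, Fin (D i),
      e'.toMvPolynomial.coeff (exponents f) ≤ e.toMvPolynomial.coeff (exponents f) := by
    intro f
    have hkey := Nat.le_of_land_sum_eq κ (c := c e) (c' := c e')
      (fun j hj => by
        rw [← hc e ⟨j, hj⟩]; exact (coeff_le_eval_one hd _).trans_lt h1)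
      (fun j hj => by
        rw [← hc e' ⟨j, hj⟩]; exact (coeff_le_eval_one hd' _).trans_lt h1')
      hbit (finPiFinEquiv f).is_lt
    rwa [← hc, ← hc, Equiv.symm_apply_apply] at hkey
  rw [eval_eq_sum ρ hd, eval_eq_sum ρ hd']
  exact Finset.sum_le_sum fun f _ => mul_le_mul_of_nonneg_right (Nat.cast_le.mpr (hle f))
    (Finset.prod_nonneg fun i _ => pow_nonneg (hρ i) _)

end PolyExpr

/-! With `u = 1 + v`, `b = 1 / (u * W)`, `g = 1 / (u * W * K)` and `c = u * K - 1`, an orbit of `T`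
that starts at `u * (x / e)`, `u * (y / e)` continues with `u * (n₂ / (u * K * d₂))`,
`u * (n₃ / d₃)` and `u * (n₄ / (u ^ 2 * K * d₄))`, for the polynomials `nᵢ` and `dᵢ` below. -/

namespace ThirdIterate

section Polynomials

variable {R : Type*} [Add R] [Mul R]

/-- The numerator of the second term. -/
def num₂ (v u W K c x y e : R) : R := u * K * W * (v * e + y) + c * e + x

/-- The denominator of the second term. -/
def den₂ (u W x y : R) : R := y + W * u * x

/-- The numerator of the third term. -/
def num₃ (v u W K c y e n₂ d₂ : R) : R := W * e * (v * u * K * d₂ + n₂) + (c * e + y) * d₂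

/-- The denominator of the third term. -/
def den₃ (u W K y e n₂ d₂ : R) : R := e * n₂ + W * u * u * K * y * d₂

/-- The numerator of the fourth term. -/
def num₄ (v u W K c n₂ d₂ n₃ d₃ : R) : R :=
  u * K * u * K * W * d₂ * (v * d₃ + n₃) + c * u * K * d₂ * d₃ + n₂ * d₃

/-- The denominator of the fourth term. -/
def den₄ (W K n₂ d₂ n₃ d₃ : R) : R := K * d₂ * n₃ + W * n₂ * d₃

/-- The value `F n₃ d₃ n₄ d₄`, with the second and third terms substituted. -/
def thirdStep (F : R → R → R → R → R) (v u W K c x y e : R) : R :=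
  (fun n₂ d₂ =>
    (fun n₃ d₃ => F n₃ d₃ (num₄ v u W K c n₂ d₂ n₃ d₃) (den₄ W K n₂ d₂ n₃ d₃))
      (num₃ v u W K c y e n₂ d₂) (den₃ u W K y e n₂ d₂))
    (num₂ v u W K c x y e) (den₂ u W x y)

/-- The numerator of the invariant at the initial point, over the denominator it has in common with
`iterateNum`. -/
def initialNum (v u K x y e n₃ d₃ n₄ d₄ : R) : R :=
  (e + u * x) * (e + u * y) * (v * e + x + y) * (n₃ * d₃) * (n₄ * d₄ * u * K)

/-- The numerator of the invariant at the third iterate, over the denominator it has in common with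
`initialNum`. -/
def iterateNum (v u K x y e n₃ d₃ n₄ d₄ : R) : R :=
  x * y * e * ((u * n₃ + d₃) * (n₄ + u * K * d₄) *
    (u * u * K * d₄ * (v * d₃ + n₃) + n₄ * d₃))

/-- `initialNum` as a polynomial in the parameters and the initial point. -/
def upper (v u W K c x y e : R) : R := thirdStep (initialNum v u K x y e) v u W K c x y e

/-- `iterateNum` as a polynomial in the parameters and the initial point. -/
def lower (v u W K c x y e : R) : R := thirdStep (iterateNum v u K x y e) v u W K c x y e

end Polynomials

/-- The term of the orbit that follows `u * p` and `u * q`. -/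
theorem next_eq {b g u v W K c : ℝ} (hu : 0 < u) (hW : 0 < W) (hK : 0 < K) (hv : u = 1 + v)
    (hc : u * K = 1 + c) (hb : b = 1 / (u * W)) (hg : g = 1 / (u * W * K)) {p q : ℝ}
    (hp : 0 < p) (hq : 0 < q) :
    ((b + 1) * u ^ 2 - (g + 1) * u + u * q + g * (u * p)) / (b * (u * q) + u * p) =
      u * ((u * K * W * (v + q) + c + p) / (u * K * (q + W * u * p))) := by
  obtain rfl : c = u * K - 1 := by linarith
  obtain rfl : v = u - 1 := by linarith
  have h1 : q + W * u * p ≠ 0 := by positivity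
  have h2 : b * (u * q) + u * p ≠ 0 := by subst hb; positivity
  rw [← mul_div_assoc, div_eq_div_iff h2 (by positivity), hb, hg]
  field_simp
  ring

theorem invariant_third_iterate_lt {b g u v W K c x y e : ℝ} (hu : 0 < u) (hW : 0 < W)
    (hK : 0 < K) (hv0 : 0 < v) (hc0 : 0 < c) (hx : 0 < x) (hy : 0 < y) (he : 0 < e) (hv : u = 1 + v)
    (hc : u * K = 1 + c) (hb : b = 1 / (u * W)) (hg : g = 1 / (u * W * K))
    (h : lower v u W K c x y e < upper v u W K c x y e)
    {T : ℝ × ℝ → ℝ × ℝ}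
    (hT : ∀ P : ℝ × ℝ, T P =
      (P.2, ((b + 1) * u ^ 2 - (g + 1) * u + P.2 + g * P.1) / (b * P.2 + P.1)))
    {G : ℝ × ℝ → ℝ}
    (hG : ∀ P : ℝ × ℝ, G P = (1 + P.1) * (1 + P.2) * (u ^ 2 - u + P.1 + P.2) / (P.1 * P.2)) :
    G (T (T (T (u * (x / e), u * (y / e))))) < G (u * (x / e), u * (y / e)) := by
  have hT' : ∀ {p q r : ℝ}, 0 < p → 0 < q →
      (u * K * W * (v + q) + c + p) / (u * K * (q + W * u * p)) = r →
      T (u * p, u * q) = (u * q, u * r) := by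
    intro p q r hp hq hr
    rw [hT, ← hr, ← next_eq hu hW hK hv hc hb hg hp hq]
  have hG' : ∀ {p q : ℝ}, 0 < p → 0 < q →
      G (u * p, u * q) = (1 + u * p) * (1 + u * q) * (v + p + q) / (u * p * q) := by
    intro p q hp hq
    obtain rfl : v = u - 1 := by linarith
    rw [hG]
    field_simp
  have compare : ∀ {n₃ d₃ n₄ d₄ : ℝ}, 0 < n₃ → 0 < d₃ → 0 < n₄ → 0 < d₄ →
      iterateNum v u K x y e n₃ d₃ n₄ d₄ < initialNum v u K x y e n₃ d₃ n₄ d₄ →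
      G (u * (n₃ / d₃), u * (n₄ / (u * u * K * d₄))) < G (u * (x / e), u * (y / e)) := by
    intro n₃ d₃ n₄ d₄ hn₃ hd₃ hn₄ hd₄ hlt
    rw [hG' (by positivity) (by positivity), hG' (by positivity) (by positivity)]
    have hl : (1 + u * (n₃ / d₃)) * (1 + u * (n₄ / (u * u * K * d₄))) *
        (v + n₃ / d₃ + n₄ / (u * u * K * d₄)) / (u * (n₃ / d₃) * (n₄ / (u * u * K * d₄))) =
        iterateNum v u K x y e n₃ d₃ n₄ d₄ /
          (u * u * K * n₃ * d₃ * n₄ * d₄ * (x * y * e)) := by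
      unfold iterateNum
      field_simp
      ring
    have hr : (1 + u * (x / e)) * (1 + u * (y / e)) * (v + x / e + y / e) /
        (u * (x / e) * (y / e)) = initialNum v u K x y e n₃ d₃ n₄ d₄ /
          (u * u * K * n₃ * d₃ * n₄ * d₄ * (x * y * e)) := by
      unfold initialNum
      field_simp
    rw [hl, hr]
    gcongr
  simp only [lower, upper, thirdStep] at h
  set n₂ := num₂ v u W K c x y e with hn₂
  set d₂ := den₂ u W x y with hd₂
  set n₃ := num₃ v u W K c y e n₂ d₂ with hn₃
  set d₃ := den₃ u W K y e n₂ d₂ with hd₃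
  set n₄ := num₄ v u W K c n₂ d₂ n₃ d₃ with hn₄
  set d₄ := den₄ W K n₂ d₂ n₃ d₃ with hd₄
  have n₂pos : 0 < n₂ := by rw [hn₂, num₂]; positivity
  have d₂pos : 0 < d₂ := by rw [hd₂, den₂]; positivity
  have n₃pos : 0 < n₃ := by rw [hn₃, num₃]; positivity
  have d₃pos : 0 < d₃ := by rw [hd₃, den₃]; positivity
  have n₄pos : 0 < n₄ := by rw [hn₄, num₄]; positivity
  have d₄pos : 0 < d₄ := by rw [hd₄, den₄]; positivity
  clear_value n₂ d₂ n₃ d₃ n₄ d₄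
  rw [hT' (r := n₂ / (u * K * d₂)) (by positivity) (by positivity),
    hT' (r := n₃ / d₃) (by positivity) (by positivity),
    hT' (r := n₄ / (u * u * K * d₄)) (by positivity) (by positivity)]
  · exact compare n₃pos d₃pos n₄pos d₄pos h
  · rw [hn₄, hd₄, num₄, den₄]
    field_simp
  · rw [hn₃, hd₃, num₃, den₃]
    field_simp
    ring
  · rw [hn₂, hd₂, num₂, den₂]
    field_simp

open PolyExpr

/-- The test that, in the variables `k`, `w`, `v`, `s`, `t`, the coefficients of
`lower + s ^ 2 + t ^ 2` are at most those of `upper`. -/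
def lowerLE (x y e : PolyExpr 5) : Bool :=
  coeffLE 65 ![9, 13, 23, 14, 14] ![1, 9, 117, 2691, 37674] 527436
    (upper (var 2) (1 + var 2) (1 + var 1) (1 + var 0) (var 2 + var 0 + var 2 * var 0) x y e)
    (lower (var 2) (1 + var 2) (1 + var 1) (1 + var 0) (var 2 + var 0 + var 2 * var 0) x y e +
      var 3 * var 3 + var 4 * var 4)

theorem lower_lt_upper {x y e : PolyExpr 5} (h : lowerLE x y e = true) {k w v s t : ℝ}
    (hk : 0 ≤ k) (hw : 0 ≤ w) (hv : 0 ≤ v) (hs : 0 ≤ s) (ht : 0 ≤ t) (hst : 0 < s * s + t * t) :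
    lower v (1 + v) (1 + w) (1 + k) (v + k + v * k) (x.eval ![k, w, v, s, t])
      (y.eval ![k, w, v, s, t]) (e.eval ![k, w, v, s, t]) <
    upper v (1 + v) (1 + w) (1 + k) (v + k + v * k) (x.eval ![k, w, v, s, t])
      (y.eval ![k, w, v, s, t]) (e.eval ![k, w, v, s, t]) := by
  have hle := eval_le_eval_of_coeffLE (ρ := ![k, w, v, s, t])
    (by simp [Fin.forall_fin_succ, Fin.prod_univ_succ, Fin.castLE]) (by simp [Fin.prod_univ_succ])
    h (by simp [Fin.forall_fin_succ, *])
  have hlt : ∀ {p q : ℝ}, p + s * s + t * t ≤ q → p < q := fun hpq => by linarith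
  exact hlt hle

theorem lowerLE_of_le : lowerLE (1 + var 3) ((1 + var 3) * (1 + var 4)) 1 = true := by
  decide +kernel

theorem lowerLE_of_ge : lowerLE ((1 + var 3) * (1 + var 4)) (1 + var 3) 1 = true := by
  decide +kernel

theorem lowerLE_of_inv_ge :
    lowerLE (1 + var 4) 1 ((1 + var 3) * (1 + var 4)) = true := by
  decide +kernel

theorem lowerLE_of_inv_le :
    lowerLE 1 (1 + var 4) ((1 + var 3) * (1 + var 4)) = true := by
  decide +kernel

end ThirdIterate

/-- Claim (case `g < b`): on the quadrants `Q₁(u,u) ∪ Q₃(u,u)` (minus `(u,u)`), the Lyness invariant `G` strictly decreases along three steps of the map `T`. -/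
theorem stmt_15 (b g u : ℝ)
    (hb0 : 0 < b) (hb1 : b < 1) (hg0 : 0 < g) (hg1 : g < 1)
    (hu1 : 1 < u) (hub : u < 1 / b) (hgu : (g + 1) / (b + 1) ≤ u)
    (hgb : g < b)
    (T : ℝ × ℝ → ℝ × ℝ)
    (hT : ∀ P : ℝ × ℝ, T P =
      (P.2, ((b + 1) * u ^ 2 - (g + 1) * u + P.2 + g * P.1) / (b * P.2 + P.1)))
    (G : ℝ × ℝ → ℝ)
    (hG : ∀ P : ℝ × ℝ, G P = (1 + P.1) * (1 + P.2) * (u ^ 2 - u + P.1 + P.2) / (P.1 * P.2))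
    (x y : ℝ) (hx : 0 < x) (hy : 0 < y)
    (hQ : (u ≤ x ∧ u ≤ y) ∨ (x ≤ u ∧ y ≤ u))
    (hne : (x, y) ≠ (u, u)) :
    G (T (T (T (x, y)))) < G (x, y) := by
  have hu : 0 < u := by linarith
  obtain ⟨v, rfl⟩ : ∃ v, u = 1 + v := ⟨u - 1, by ring⟩
  obtain ⟨w, hw⟩ : ∃ w, 1 / (b * (1 + v)) = 1 + w := ⟨1 / (b * (1 + v)) - 1, by ring⟩
  obtain ⟨k, hk⟩ : ∃ k, b / g = 1 + k := ⟨b / g - 1, by ring⟩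
  have hv0 : 0 < v := by linarith
  have hw0 : 0 < w := by
    have : 1 < 1 / (b * (1 + v)) := by
      rw [lt_div_iff₀ hb0] at hub
      rw [lt_div_iff₀ (by positivity)]
      linarith
    linarith
  have hk0 : 0 < k := by
    have : 1 < b / g := by rwa [lt_div_iff₀ hg0, one_mul]
    linarith
  have hb : b = 1 / ((1 + v) * (1 + w)) := by
    rw [← hw]
    field_simp
  have hg : g = 1 / ((1 + v) * (1 + w) * (1 + k)) := by
    rw [← hw, ← hk]
    field_simp
  have key : ∀ {p q e : PolyExpr 5} {s t : ℝ}, ThirdIterate.lowerLE p q e = true →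
      1 ≤ s → 1 ≤ t → (s ≠ 1 ∨ t ≠ 1) → ∀ {p' q' e' : ℝ},
      p.eval ![k, w, v, s - 1, t - 1] = p' → q.eval ![k, w, v, s - 1, t - 1] = q' →
      e.eval ![k, w, v, s - 1, t - 1] = e' → 0 < p' → 0 < q' → 0 < e' →
      (1 + v) * (p' / e') = x → (1 + v) * (q' / e') = y →
      G (T (T (T (x, y)))) < G (x, y) := by
    intro p q e s t htest hs ht hst p' q' e' hp hq he hp0 hq0 he0 hx' hy'
    have hpos : 0 < (s - 1) * (s - 1) + (t - 1) * (t - 1) := by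
      rcases hst with h | h
      · have := mul_self_pos.mpr (sub_ne_zero.mpr h)
        positivity
      · have := mul_self_pos.mpr (sub_ne_zero.mpr h)
        positivity
    have hlt := ThirdIterate.lower_lt_upper htest hk0.le hw0.le hv0.le (sub_nonneg.mpr hs)
      (sub_nonneg.mpr ht) hpos
    rw [hp, hq, he] at hlt
    rw [← hx', ← hy']
    exact ThirdIterate.invariant_third_iterate_lt hu (by positivity) (by positivity) hv0
      (by positivity) hp0 hq0 he0 rfl (by ring) hb hg hlt hT hG
  have hne' : x = 1 + v → y ≠ 1 + v := fun h h' => hne (by rw [h, h'])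
  rcases hQ with ⟨hxu, hyu⟩ | ⟨hxu, hyu⟩ <;> rcases le_total x y with hxy | hxy
  · refine key (s := x / (1 + v)) (t := y / x) ThirdIterate.lowerLE_of_le
      ((one_le_div hu).mpr hxu) ((one_le_div hx).mpr hxy) ?_
      (p' := x / (1 + v)) (q' := y / (1 + v)) (e' := 1) (by simp) (by simp; field_simp) (by simp)
      (by positivity) (by positivity) (by positivity) (by field_simp) (by field_simp)
    rw [← not_and_or, div_eq_one_iff_eq hu.ne', div_eq_one_iff_eq hx.ne']
    exact fun h => hne' h.1 (h.2.trans h.1)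
  · refine key (s := y / (1 + v)) (t := x / y) ThirdIterate.lowerLE_of_ge
      ((one_le_div hu).mpr hyu) ((one_le_div hy).mpr hxy) ?_
      (p' := x / (1 + v)) (q' := y / (1 + v)) (e' := 1) (by simp; field_simp) (by simp) (by simp)
      (by positivity) (by positivity) (by positivity) (by field_simp) (by field_simp)
    rw [← not_and_or, div_eq_one_iff_eq hu.ne', div_eq_one_iff_eq hy.ne']
    exact fun h => hne' (h.2.trans h.1) h.1
  · refine key (s := (1 + v) / y) (t := y / x) ThirdIterate.lowerLE_of_inv_le
      ((one_le_div hy).mpr hyu) ((one_le_div hx).mpr hxy) ?_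
      (p' := 1) (q' := y / x) (e' := (1 + v) / x) (by simp) (by simp) (by simp; field_simp)
      (by positivity) (by positivity) (by positivity) (by field_simp) (by field_simp)
    rw [← not_and_or, div_eq_one_iff_eq hy.ne', div_eq_one_iff_eq hx.ne']
    exact fun h => hne' (h.2.symm.trans h.1.symm) h.1.symm
  · refine key (s := (1 + v) / x) (t := x / y) ThirdIterate.lowerLE_of_inv_ge
      ((one_le_div hx).mpr hxu) ((one_le_div hy).mpr hxy) ?_
      (p' := x / y) (q' := 1) (e' := (1 + v) / y) (by simp) (by simp) (by simp; field_simp)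
      (by positivity) (by positivity) (by positivity) (by field_simp) (by field_simp)
    rw [← not_and_or, div_eq_one_iff_eq hx.ne', div_eq_one_iff_eq hy.ne']
    exact fun h => hne' h.1.symm (h.2.symm.trans h.1.symm)
end

section
/- Let p, q > 0 and r ≥ 0, and set f(x,y) = (r + p·x + y)/(q·x + y). Let m, M be positive reals. Then: (a) if f(m,m) = m and f(M,M) = M, then m = M; and (b) if f(m,m) = M and f(M,M) = m, then m = M. In other words, neither of the systems {M = f(M,M), m = f(m,m)} and {M = f(m,m), m = f(M,M)} has a solution with 0 < m < M. -/
/-- Lemma: for `p, q > 0`, `r ≥ 0` and `f(x,y) = (r + px + y)/(qx + y)`, neither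
of the diagonal systems `{m = f(m,m), M = f(M,M)}` and `{M = f(m,m), m = f(M,M)}`
has a solution with `m ≠ M` among positive reals. -/
theorem stmt_16 (p q r : ℝ) (hp : 0 < p) (hq : 0 < q) (hr : 0 ≤ r)
    (m M : ℝ) (hm : 0 < m) (hM : 0 < M) :
    ((r + p * m + m) / (q * m + m) = m → (r + p * M + M) / (q * M + M) = M → m = M) ∧
    ((r + p * m + m) / (q * m + m) = M → (r + p * M + M) / (q * M + M) = m → m = M) := by
  have hqm : q * m + m ≠ 0 := by positivity
  have hqM : q * M + M ≠ 0 := by positivity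
  rw [div_eq_iff hqm, div_eq_iff hqM, div_eq_iff hqm, div_eq_iff hqM]
  refine ⟨fun h₁ h₂ => ?_, fun h₁ h₂ => ?_⟩
  · have h : (m - M) * (r + (q + 1) * (m * M)) = 0 := by
      linear_combination m * h₂ - M * h₁
    have hpos : r + (q + 1) * (m * M) ≠ 0 := by positivity
    exact sub_eq_zero.mp ((mul_eq_zero.mp h).resolve_right hpos)
  · have h : (p + 1) * (m - M) = 0 := by linear_combination h₁ - h₂
    have hpos : p + 1 ≠ 0 := by positivity
    exact sub_eq_zero.mp ((mul_eq_zero.mp h).resolve_left hpos)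
end

section
/- Let p, q > 0 with p ≠ q and r ≥ 0, and let ȳ = (p+1+√((p+1)² + 4r(q+1)))/(2(q+1)). Suppose q·r < (p − q)·ȳ and (q − p)·ȳ < r. Then p > q and q²·r < p·(p − q), i.e., q·r/(p − q) < p/q. -/
/-- Lemma: if the equilibrium `ȳ` of Eq. (3-2) satisfies `qr < (p − q)ȳ` and
`(q − p)ȳ < r` (i.e. `f` is increasing in `x` and decreasing in `y` at the
equilibrium), then `p > q` and `qr/(p − q) < p/q`. -/
theorem stmt_18 (p q r : ℝ) (hp : 0 < p) (hq : 0 < q) (hpq : p ≠ q) (hr : 0 ≤ r)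
    (ybar : ℝ)
    (hybar : ybar = (p + 1 + Real.sqrt ((p + 1) ^ 2 + 4 * r * (q + 1))) / (2 * (q + 1)))
    (h1 : q * r < (p - q) * ybar) (h2 : (q - p) * ybar < r) :
    q < p ∧ q ^ 2 * r < p * (p - q) ∧ q * r / (p - q) < p / q := by
  have hD : 0 ≤ (p + 1) ^ 2 + 4 * r * (q + 1) := by positivity
  have hy : 0 < ybar := by rw [hybar]; positivity
  have hlt : q < p := by
    by_contra! h
    nlinarith [mul_nonneg hq.le hr, mul_nonneg (sub_nonneg.2 h) hy.le]
  have hsqrt : Real.sqrt ((p + 1) ^ 2 + 4 * r * (q + 1)) = 2 * (q + 1) * ybar - (p + 1) := by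
    rw [hybar]; field_simp; ring
  have heq : (q + 1) * ybar ^ 2 = (p + 1) * ybar + r := by
    have hsq := Real.sq_sqrt hD
    rw [hsqrt] at hsq
    have h4 : 4 * (q + 1) * ((q + 1) * ybar ^ 2) = 4 * (q + 1) * ((p + 1) * ybar + r) := by
      linear_combination hsq
    exact mul_left_cancel₀ (by positivity) h4
  have hqy : q * ybar < p := by
    have hmul : ((q + 1) * ybar) * (q * ybar) < ((q + 1) * ybar) * p := by
      linear_combination q * heq + h1
    exact lt_of_mul_lt_mul_left hmul (by positivity)
  have hmain : q ^ 2 * r < p * (p - q) := by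
    linear_combination q * h1 + (p - q) * hqy
  refine ⟨hlt, hmain, ?_⟩
  rw [div_lt_div_iff₀ (sub_pos.2 hlt) hq]
  linear_combination hmain
end

section
/- Let p, q > 0 and r ≥ 0, set f(x,y) = (r + p·x + y)/(q·x + y), and define 𝓛 = min{p/q, 1} and 𝓤 = max{p/q, 1, (r + (p+1)·𝓛)/((q+1)·𝓛)}. Then 𝓛 > 0, and: (i) 𝓛 ≤ f(x,y) for all x, y > 0; (ii) f(x,y) ∈ [𝓛, 𝓤] for all x, y ∈ [𝓛, 𝓤]; and (iii) every sequence (x_n)_{n≥-1} of positive reals satisfying x_{n+1} = f(x_n, x_{n-1}) for all n ≥ 0 satisfies x_n ∈ [𝓛, 𝓤] for all n ≥ 3. -/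
open Set

/-- Lemma (boundedness for Eq. (3-2)): with `𝓛 = min{p/q, 1}` and
`𝓤 = max{p/q, 1, (r + (p+1)𝓛)/((q+1)𝓛)}`, one has `𝓛 > 0`, `𝓛 ≤ f(x,y)` for
all positive `x, y`, the interval `[𝓛, 𝓤]` is invariant under `f`, and every
positive solution satisfies `x_n ∈ [𝓛, 𝓤]` for all `n ≥ 3`.
Here `x 0` plays the role of `x_{-1}` and `x 1` of `x_0`, so the paper index
`n ≥ 3` corresponds to the Lean index `n ≥ 4`. -/
theorem stmt_19 (p q r : ℝ) (hp : 0 < p) (hq : 0 < q) (hr : 0 ≤ r)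
    (f : ℝ → ℝ → ℝ) (hf : ∀ x y : ℝ, f x y = (r + p * x + y) / (q * x + y))
    (𝓛 𝓤 : ℝ)
    (hL : 𝓛 = min (p / q) 1)
    (hU : 𝓤 = max (max (p / q) 1) ((r + (p + 1) * 𝓛) / ((q + 1) * 𝓛))) :
    0 < 𝓛 ∧
    (∀ x y : ℝ, 0 < x → 0 < y → 𝓛 ≤ f x y) ∧
    (∀ x ∈ Icc 𝓛 𝓤, ∀ y ∈ Icc 𝓛 𝓤, f x y ∈ Icc 𝓛 𝓤) ∧
    (∀ x : ℕ → ℝ, (∀ n : ℕ, 0 < x n) →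
      (∀ n : ℕ, x (n + 2) = f (x (n + 1)) (x n)) →
      ∀ n : ℕ, 4 ≤ n → x n ∈ Icc 𝓛 𝓤) := by
  have hL0 : 0 < 𝓛 := hL ▸ lt_min (div_pos hp hq) one_pos
  have hLq : 𝓛 * q ≤ p := (le_div_iff₀ hq).1 (hL ▸ min_le_left _ _)
  have hL1 : 𝓛 ≤ 1 := hL ▸ min_le_right _ _
  have hUq : p ≤ 𝓤 * q :=
    (div_le_iff₀ hq).1 (hU ▸ (le_max_left _ _).trans (le_max_left _ _))
  have hU1 : 1 ≤ 𝓤 := hU ▸ (le_max_right _ _).trans (le_max_left _ _)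
  have hUL : r + (p + 1) * 𝓛 ≤ 𝓤 * ((q + 1) * 𝓛) :=
    (div_le_iff₀ (by positivity)).1 (hU ▸ le_max_right _ _)
  have lower : ∀ x y : ℝ, 0 < x → 0 < y → 𝓛 ≤ f x y := by
    intro x y hx hy
    rw [hf, le_div_iff₀ (by positivity)]
    linarith [mul_le_mul_of_nonneg_right hLq hx.le, mul_le_mul_of_nonneg_right hL1 hy.le]
  have upper : ∀ x y : ℝ, 𝓛 ≤ x → 𝓛 ≤ y → f x y ≤ 𝓤 := by
    intro x y hx hy
    have hx0 := hL0.trans_le hx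
    have hy0 := hL0.trans_le hy
    rw [hf, div_le_iff₀ (by positivity)]
    linarith [mul_le_mul_of_nonneg_left hx (sub_nonneg.2 hUq),
      mul_le_mul_of_nonneg_left hy (sub_nonneg.2 hU1)]
  refine ⟨hL0, lower, fun x hx y hy => ⟨lower x y (hL0.trans_le hx.1) (hL0.trans_le hy.1),
    upper x y hx.1 hy.1⟩, fun x hpos hrec n hn => ?_⟩
  have hge : ∀ k, 𝓛 ≤ x (k + 2) := fun k => hrec k ▸ lower _ _ (hpos _) (hpos _)
  obtain ⟨k, rfl⟩ := Nat.exists_eq_add_of_le' hn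
  exact ⟨hge (k + 2), hrec (k + 2) ▸ upper _ _ (hge (k + 1)) (hge k)⟩
end
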